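/- Let K be a number field with ring of integers 𝓞_K, let d ≥ 2, let c ∈ 𝓞_K, and let f(x) = x^d + c. Suppose 0 is not preperiodic under f, i.e., f^{∘m}(0) ≠ f^{∘n}(0) for all integers m > n ≥ 0. Then for every ε > 0 there are infinitely many nonzero prime ideals 𝔭 of 𝓞_K with #Per(f_𝔭) ≤ ε·(N(𝔭) + 1); that is, the liminf over primes 𝔭 of #Per(f_𝔭)/(N(𝔭)+1) is 0. -/

import Mathlib

open NumberField Polynomial

/-- The number of periodic points of the self-map of `R ⧸ I` induced by a polynomial
`f ∈ R[x]` (reduce the coefficients of `f` modulo `I` and iterate evaluation). -/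
noncomputable def perCount {R : Type*} [CommRing R] (f : Polynomial R) (I : Ideal R) : ℕ :=
  Set.ncard {z : R ⧸ I | ∃ m : ℕ, 0 < m ∧
    (fun w => (f.map (Ideal.Quotient.mk I)).eval w)^[m] z = z}


universe u

/-- A filtered `k`-algebra with a derivation, abstracting the coordinate ring of an affine curve. -/
structure GoodCurve (k : Type u) (R : Type u) [Field k] [CommRing R] [Algebra k R]
    (r C : ℕ) (x : R) where
  F : ℕ → Submodule k R
  mono : Monotone F
  poly_mem : ∀ (p : k[X]) (n : ℕ), p.natDegree ≤ n → aeval x p ∈ F n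
  mul_mem : ∀ (i j : ℕ) (a b : R), a ∈ F i → b ∈ F j → a * b ∈ F (i + j + C)
  fin : ∀ n, Module.Finite k (F n)
  rank : ∀ n, Module.finrank k (F n) = r * (n + 1)
  exh : ∀ a, ∃ n, a ∈ F n
  D : Derivation k R R
  D_mem : ∀ (n : ℕ) (a : R), a ∈ F n → D a ∈ F (n + C)

section jets

variable {k R : Type u} [Field k] [CommRing R] [Algebra k R] (D : Derivation k R R)

/-- `b` vanishes to order `L` at `P`. -/
def Van (P : R →ₐ[k] k) (L : ℕ) (b : R) : Prop := ∀ i < L, P (D^[i] b) = 0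

variable {D} {P : R →ₐ[k] k}

lemma Van.succ_iff {L : ℕ} {b : R} : Van D P (L + 1) b ↔ P b = 0 ∧ Van D P L (D b) := by
  constructor
  · intro h
    refine ⟨by simpa using h 0 (by omega), fun i hi => ?_⟩
    have := h (i + 1) (by omega)
    rwa [Function.iterate_succ_apply] at this
  · rintro ⟨h0, h⟩ i hi
    rcases i with _ | i
    · simpa using h0
    · rw [Function.iterate_succ_apply]; exact h i (by omega)

lemma Van.mono {L L' : ℕ} {b : R} (h : Van D P L b) (hl : L' ≤ L) : Van D P L' b :=
  fun i hi => h i (by omega)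

lemma iterD_add (i : ℕ) (a b : R) : D^[i] (a + b) = D^[i] a + D^[i] b := by
  induction i generalizing a b with
  | zero => rfl
  | succ i ih => simp [Function.iterate_succ_apply, ih]

lemma iterD_zero (i : ℕ) : D^[i] (0 : R) = 0 := by
  induction i with
  | zero => rfl
  | succ i ih => simp [Function.iterate_succ_apply, ih]

lemma iterD_smul (i : ℕ) (c : k) (b : R) : D^[i] (c • b) = c • D^[i] b := by
  induction i generalizing b with
  | zero => rfl
  | succ i ih => simp [Function.iterate_succ_apply, ih]

lemma iterD_sum {ι : Type*} (i : ℕ) (s : Finset ι) (f : ι → R) :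
    D^[i] (∑ j ∈ s, f j) = ∑ j ∈ s, D^[i] (f j) := by
  classical
  induction s using Finset.induction_on with
  | empty => simp
  | insert a s ha ih => simp [Finset.sum_insert ha, ih]

lemma iterD_const_mul (i : ℕ) (a b : R) (ha : D a = 0) : D^[i] (a * b) = a * D^[i] b := by
  induction i generalizing b with
  | zero => rfl
  | succ i ih => simp [Function.iterate_succ_apply, ha, ih]

lemma Van.add {L : ℕ} {a b : R} (ha : Van D P L a) (hb : Van D P L b) : Van D P L (a + b) := by
  intro i hi; rw [iterD_add, map_add, ha i hi, hb i hi, add_zero]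

lemma Van.mul_left {L : ℕ} {b : R} (a : R) (h : Van D P L b) : Van D P L (a * b) := by
  induction L generalizing a b with
  | zero => intro i hi; omega
  | succ L ih =>
    rw [Van.succ_iff]
    refine ⟨by simp [(Van.succ_iff.1 h).1], ?_⟩
    rw [Derivation.leibniz, smul_eq_mul, smul_eq_mul]
    refine Van.add (ih a (Van.succ_iff.1 h).2) ?_
    rw [mul_comm]; exact ih _ (h.mono (by omega))

lemma Van.mul_zero_left {L : ℕ} {t b : R} (ht : P t = 0) (h : Van D P L b) :
    Van D P (L + 1) (t * b) := by
  induction L generalizing b with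
  | zero => intro i hi; obtain rfl : i = 0 := by omega
            simp [ht]
  | succ L ih =>
    rw [Van.succ_iff]
    refine ⟨by simp [ht], ?_⟩
    rw [Derivation.leibniz, smul_eq_mul, smul_eq_mul]
    refine Van.add (ih (Van.succ_iff.1 h).2) ?_
    rw [mul_comm]; exact h.mul_left _

lemma Van.pow {t : R} (ht : P t = 0) (L : ℕ) : Van D P L (t ^ L) := by
  induction L with
  | zero => intro i hi; omega
  | succ L ih => rw [pow_succ']; exact ih.mul_zero_left ht

lemma Van.top_mul {L : ℕ} {b : R} (a : R) (h : Van D P L b) :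
    P (D^[L] (a * b)) = P a * P (D^[L] b) := by
  induction L generalizing a b with
  | zero => simp
  | succ L ih =>
    rw [Function.iterate_succ_apply, Function.iterate_succ_apply, Derivation.leibniz, smul_eq_mul,
      smul_eq_mul, iterD_add, map_add, ih a (Van.succ_iff.1 h).2, mul_comm b,
      (h.mul_left (D a)) L (by omega), add_zero]

lemma Van.top_mul_zero {L : ℕ} {t b : R} (ht : P t = 0) (h : Van D P L b) :
    P (D^[L + 1] (t * b)) = (L + 1) * P (D t) * P (D^[L] b) := by
  induction L generalizing b with
  | zero => simp [ht, mul_comm]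
  | succ L ih =>
    rw [Function.iterate_succ_apply, Derivation.leibniz, smul_eq_mul,
      smul_eq_mul, iterD_add, map_add, ih (Van.succ_iff.1 h).2, mul_comm b, h.top_mul,
      Function.iterate_succ_apply]
    push_cast; ring

lemma Van.top_pow {t : R} (ht : P t = 0) (L : ℕ) :
    P (D^[L] (t ^ L)) = (L.factorial : k) * P (D t) ^ L := by
  induction L with
  | zero => simp
  | succ L ih =>
    rw [pow_succ', (Van.pow ht L).top_mul_zero ht, ih, Nat.factorial_succ]
    push_cast; ring

lemma exists_jet (p : ℕ) [CharP k p] (hp : p.Prime) {x : R} (hx : P (D x) ≠ 0) (v : ℕ → k) (L : ℕ)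
    (hL : L ≤ p) : ∃ b : R, ∀ i < L, P (D^[i] b) = v i := by
  induction L with
  | zero => exact ⟨0, fun i hi => by omega⟩
  | succ L ih =>
    obtain ⟨b, hb⟩ := ih (by omega)
    set t : R := x - algebraMap k R (P x) with ht
    have ht0 : P t = 0 := by simp [ht]
    have hDt : P (D t) ≠ 0 := by simpa [ht] using hx
    have hfac : P (D^[L] (t ^ L)) ≠ 0 := by
      rw [Van.top_pow ht0]
      refine mul_ne_zero ?_ (pow_ne_zero _ hDt)
      rw [Ne, CharP.cast_eq_zero_iff k p, hp.dvd_factorial]; omega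
    refine ⟨b + ((v L - P (D^[L] b)) / P (D^[L] (t ^ L))) • t ^ L, fun i hi => ?_⟩
    rw [iterD_add, iterD_smul, map_add, map_smul, smul_eq_mul]
    rcases Nat.lt_succ_iff_lt_or_eq.1 hi with h | rfl
    · rw [Van.pow ht0 L i h, hb i h]; simp
    · field_simp; ring

lemma exists_sep {P Q : R →ₐ[k] k} (h : P ≠ Q) : ∃ w : R, P w = 1 ∧ Q w = 0 := by
  obtain ⟨a, ha⟩ : ∃ a, P a ≠ Q a := by
    by_contra hcon; push Not at hcon; exact h (AlgHom.ext hcon)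
  have hne : P a - Q a ≠ 0 := sub_ne_zero.2 ha
  refine ⟨(P a - Q a)⁻¹ • (a - algebraMap k R (Q a)), ?_, ?_⟩
  · simp [hne]
  · simp

lemma exists_unit_jet (S : Finset (R →ₐ[k] k)) (P : R →ₐ[k] k) (L : ℕ) :
    ∃ u : R, Van D P L (1 - u) ∧ ∀ Q ∈ S, Q ≠ P → Van D Q L u := by
  classical
  have hw : ∀ Q : R →ₐ[k] k, ∃ w : R, P w = 1 ∧ (Q ≠ P → Q w = 0) := by
    intro Q
    by_cases h : Q = P
    · exact ⟨1, by simp, fun h' => (h' h).elim⟩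
    · obtain ⟨w, h1, h2⟩ := exists_sep (Ne.symm h)
      exact ⟨w, h1, fun _ => h2⟩
  choose w hw1 hw2 using hw
  set W := (∏ Q ∈ S, w Q) ^ L with hW
  have hPW : P W = 1 := by simp [hW, map_prod, hw1]
  refine ⟨1 - (1 - W) ^ L, ?_, ?_⟩
  · rw [sub_sub_cancel]; exact Van.pow (by simp [hPW]) L
  · intro Q hQ hne
    have h1 : Van D Q L W := by
      apply Van.pow
      rw [map_prod]
      exact Finset.prod_eq_zero hQ (hw2 Q hne)
    obtain ⟨z, hz⟩ : W ∣ 1 - (1 - W) ^ L := by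
      have := sub_dvd_pow_sub_pow (1 : R) (1 - W) L
      simpa using this
    rw [hz, mul_comm]; exact h1.mul_left _

lemma exists_jets (p : ℕ) [CharP k p] (hp : p.Prime) {x : R} (S : Finset (R →ₐ[k] k))
    (hS : ∀ P ∈ S, P (D x) ≠ 0) (L : ℕ) (hL : L ≤ p) (v : (R →ₐ[k] k) → ℕ → k) :
    ∃ b : R, ∀ P ∈ S, ∀ i < L, P (D^[i] b) = v P i := by
  classical
  have h1 : ∀ P : R →ₐ[k] k, ∃ b : R, P ∈ S → ∀ i < L, P (D^[i] b) = v P i := by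
    intro P
    by_cases h : P ∈ S
    · obtain ⟨b, hb⟩ := exists_jet p hp (hS P h) (v P) L hL
      exact ⟨b, fun _ => hb⟩
    · exact ⟨0, fun h' => (h h').elim⟩
  choose b hb using h1
  choose U hU1 hU2 using fun P => exists_unit_jet (D := D) S P L
  refine ⟨∑ Q ∈ S, b Q * U Q, fun P hP i hi => ?_⟩
  rw [iterD_sum, map_sum, Finset.sum_eq_single P]
  · have := (hU1 P).mul_left (b P) i hi
    rw [mul_sub, mul_one] at this
    have h2 : b P = (b P - b P * U P) + b P * U P := by ring
    rw [← hb P hP i hi]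
    conv_rhs => rw [h2, iterD_add, map_add, this, zero_add]
  · intro Q hQ hne
    exact (hU2 Q P hP (Ne.symm hne)).mul_left _ i hi
  · intro h; exact (h hP).elim

end jets

lemma zero_count {k R : Type u} [Field k] [Finite k] [CommRing R] [IsDomain R] [Algebra k R]
    {r C : ℕ} {x : R} (G : GoodCurve k R r C x) (p : ℕ) [CharP k p] (hp : p.Prime)
    (S : Finset (R →ₐ[k] k)) (hS : ∀ P ∈ S, P (G.D x) ≠ 0) (L : ℕ) (hL : L ≤ p)
    (n : ℕ) (h : R) (h0 : h ≠ 0) (hn : h ∈ G.F n) (hv : ∀ P ∈ S, Van G.D P L h) :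
    L * S.card ≤ r * (n + C) := by
  classical
  let jet : (R →ₐ[k] k) → ℕ → (R →ₗ[k] k) := fun P i =>
    { toFun := fun b => P (G.D^[i] b)
      map_add' := fun a b => by rw [iterD_add, map_add]
      map_smul' := fun c b => by rw [iterD_smul, map_smul]; rfl }
  let Φ : R →ₗ[k] (S → Fin L → k) := LinearMap.pi fun P => LinearMap.pi fun i => jet P.1 i
  have hsurj : Function.Surjective Φ := by
    intro v
    obtain ⟨b, hb⟩ := exists_jets (D := G.D) p hp S hS L hL
      (fun P i => if hP : P ∈ S then (if hi : i < L then v ⟨P, hP⟩ ⟨i, hi⟩ else 0) else 0)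
    refine ⟨b, ?_⟩
    funext P i
    have := hb P.1 P.2 i.1 i.2
    rw [dif_pos P.2, dif_pos i.2] at this
    exact this
  choose b hb using hsurj
  choose N hN using fun v => G.exh (b v)
  obtain ⟨N0, hN0⟩ := Finite.bddAbove_range N
  have hmem : ∀ v, b v ∈ G.F N0 := fun v => G.mono (hN0 ⟨v, rfl⟩) (hN v)
  let N1 := n + N0 + C
  have := G.fin
  let Ψ : G.F N1 →ₗ[k] (S → Fin L → k) := Φ ∘ₗ (G.F N1).subtype
  have hr : LinearMap.range Ψ = ⊤ := by
    rw [LinearMap.range_eq_top]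
    intro v
    exact ⟨⟨b v, G.mono (by omega) (hmem v)⟩, hb v⟩
  let μ : G.F N0 →ₗ[k] LinearMap.ker Ψ :=
    { toFun := fun a => ⟨⟨a.1 * h, by
        have := G.mul_mem _ _ _ _ hn a.2
        rw [mul_comm]; exact this⟩, by
        rw [LinearMap.mem_ker]
        funext P i
        exact (hv P.1 P.2).mul_left a.1 i.1 i.2⟩
      map_add' := fun a b => by ext; simp [add_mul]
      map_smul' := fun c b => by ext; simp }
  have hμ : Function.Injective μ := by
    intro a b hab
    have h1 : a.1 * h = b.1 * h := congrArg (fun z => (z.1.1 : R)) hab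
    exact Subtype.ext (mul_right_cancel₀ h0 h1)
  have h1 := LinearMap.finrank_le_finrank_of_injective hμ
  have h2 := LinearMap.finrank_range_add_finrank_ker Ψ
  rw [hr, finrank_top, G.rank] at h2
  rw [G.rank] at h1
  have h3 : Module.finrank k (S → Fin L → k) = S.card * L := by
    simp [Module.finrank_pi_fintype]
  rw [h3] at h2
  have h4 : r * (N1 + 1) = r * (N0 + 1) + r * (n + C) := by simp only [N1]; ring
  nlinarith

lemma pow_mem_F {k R : Type u} [Field k] [CommRing R] [Algebra k R]
    {r C : ℕ} {x : R} (G : GoodCurve k R r C x) (l : ℕ) (a : R) (ha : a ∈ G.F l) (n : ℕ) :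
    a ^ n ∈ G.F (n * (l + C)) := by
  induction n with
  | zero => simpa using G.poly_mem 1 0 (by simp)
  | succ n ih =>
    rw [pow_succ]
    have := G.mul_mem _ _ _ _ ih ha
    convert this using 2; ring

lemma iterD_mem_F {k R : Type u} [Field k] [CommRing R] [Algebra k R]
    {r C : ℕ} {x : R} (G : GoodCurve k R r C x) (l : ℕ) (a : R) (ha : a ∈ G.F l) (n : ℕ) :
    G.D^[n] a ∈ G.F (l + n * C) := by
  induction n with
  | zero => simpa using ha
  | succ n ih =>
    rw [Function.iterate_succ_apply']
    have := G.D_mem _ _ ih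
    convert this using 2; ring

/-- Stepanov-type bound. -/
lemma stepanov {k R : Type u} [Field k] [Fintype k] [CommRing R] [IsDomain R] [Algebra k R]
    {r C : ℕ} {x : R} (G : GoodCurve k R r C x) (p : ℕ) [CharP k p] (hp : p.Prime)
    (S : Finset (R →ₐ[k] k)) (hS : ∀ P ∈ S, P (G.D x) ≠ 0) (M l m : ℕ)
    (hM : M ≤ p) (hm : r * (m + C) < p)
    (hcount : M * (l + m + M * C + 1) < r * (l + 1) * (m + 1)) :
    M * S.card ≤ r * (Fintype.card k * (l + C) + m + 2 * C) := by
  classical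
  rcases S.eq_empty_or_nonempty with rfl | ⟨P0, hP0⟩
  · simp
  have hr0 : 0 < r := by
    rcases Nat.eq_zero_or_pos r with rfl | h
    · simp at hcount
    · exact h
  have := G.fin
  set q := Fintype.card k with hq
  let β := Module.finBasis k (G.F m)
  set s := Module.finrank k (G.F m) with hs
  let T : (Fin s → G.F l) →ₗ[k] (Fin M → G.F (l + m + M * C)) :=
    { toFun := fun a i => ⟨∑ j, (a j).1 * G.D^[i] (β j).1, by
        refine Submodule.sum_mem _ fun j _ => ?_
        have := G.mul_mem _ _ _ _ (a j).2 (iterD_mem_F G _ _ (β j).2 i)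
        refine G.mono ?_ this
        have h1 : (i.1 + 1) * C ≤ M * C := Nat.mul_le_mul_right _ i.2
        nlinarith⟩
      map_add' := fun a b => by
        ext i; simp [add_mul, Finset.sum_add_distrib]
      map_smul' := fun c b => by
        ext i; simp [Finset.smul_sum] }
  have hT : LinearMap.ker T ≠ ⊥ := by
    apply LinearMap.ker_ne_bot_of_finrank_lt
    simp only [Module.finrank_pi_fintype, G.rank, Finset.sum_const, Finset.card_univ,
      Fintype.card_fin, smul_eq_mul]
    rw [hs, G.rank]
    nlinarith
  obtain ⟨a, haT, ha0⟩ := Submodule.exists_mem_ne_zero_of_ne_bot hT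
  have hrel : ∀ i < M, ∑ j, (a j).1 * G.D^[i] (β j).1 = 0 := by
    intro i hi
    have := congrFun (LinearMap.mem_ker.1 haT) ⟨i, hi⟩
    exact congrArg Subtype.val this
  have hqk : (q : R) = 0 := by
    have : ((q : k) : k) = 0 := by rw [hq]; exact FiniteField.cast_card_eq_zero k
    rw [← map_natCast (algebraMap k R), this, map_zero]
  have hDq : ∀ y : R, G.D (y ^ q) = 0 := by
    intro y; rw [Derivation.leibniz_pow, ← Nat.cast_smul_eq_nsmul R, hqk, zero_smul]
  set h : R := ∑ j, (a j).1 ^ q * (β j).1 with hh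
  have hDh : ∀ i, G.D^[i] h = ∑ j, (a j).1 ^ q * G.D^[i] (β j).1 := by
    intro i
    rw [hh, iterD_sum]
    exact Finset.sum_congr rfl fun j _ => iterD_const_mul _ _ _ (hDq _)
  have hmem : h ∈ G.F (q * (l + C) + m + C) := by
    refine Submodule.sum_mem _ fun j _ => ?_
    exact G.mul_mem _ _ _ _ (pow_mem_F G l _ (a j).2 q) (β j).2
  have hvan : ∀ P ∈ S, Van G.D P M h := by
    intro P _ i hi
    rw [hDh, map_sum]
    have := congrArg P (hrel i hi)
    rw [map_sum, map_zero] at this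
    rw [← this]
    refine Finset.sum_congr rfl fun j _ => ?_
    rw [map_mul, map_mul, map_pow, hq, FiniteField.pow_card]
  have hne : h ≠ 0 := by
    intro hzero
    -- jets at `P0`
    set L := r * (m + C) + 1 with hL
    let J : G.F m →ₗ[k] (Fin L → k) :=
      { toFun := fun b i => P0 (G.D^[i] b.1)
        map_add' := fun a b => by funext i; simp
        map_smul' := fun c b => by funext i; simp [iterD_smul] }
    have hJ : Function.Injective J := by
      rw [← LinearMap.ker_eq_bot, LinearMap.ker_eq_bot']
      intro b hb
      by_contra hb0
      have h1 := zero_count G p hp {P0} (by simpa using hS P0 hP0) L (by omega) m b.1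
        (fun h => hb0 (Subtype.ext h)) b.2 (by
          intro P hP i hi
          rw [Finset.mem_singleton.1 hP]
          exact congrFun hb ⟨i, hi⟩)
      simp at h1
      omega
    obtain ⟨Lf, hLf⟩ := LinearMap.exists_leftInverse_of_injective J (LinearMap.ker_eq_bot.2 hJ)
    -- matrix over R
    let Nm : Matrix (Fin s) (Fin L) k := fun i t => β.repr (Lf (Pi.single t 1)) i
    let A : Matrix (Fin s) (Fin s) R := fun i j =>
      ∑ t, algebraMap k R (Nm i t) * G.D^[t] (β j).1
    have hA : P0.toRingHom.mapMatrix A = 1 := by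
      ext i j
      have h1 : β.repr (Lf (J (β j))) i = (1 : Matrix (Fin s) (Fin s) k) i j := by
        have : Lf (J (β j)) = β j := LinearMap.congr_fun hLf (β j)
        rw [this, Matrix.one_apply]
        simp [Finsupp.single_apply, eq_comm]
      rw [← h1]
      have h2 : J (β j) = ∑ t : Fin L, (P0 (G.D^[t] (β j).1)) • (Pi.single t (1 : k) : Fin L → k) := by
        funext t
        simp [J, Finset.sum_apply, Pi.single_apply]
      rw [h2, map_sum, map_sum, Finsupp.finsetSum_apply]
      change P0 (∑ t, algebraMap k R (Nm i t) * G.D^[t] (β j).1) = _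
      rw [map_sum]
      refine Finset.sum_congr rfl fun t _ => ?_
      simp [Nm, mul_comm]
    have hdet : A.det ≠ 0 := by
      intro h0
      have h1 := RingHom.map_det P0.toRingHom A
      rw [hA, h0, Matrix.det_one, map_zero] at h1
      exact zero_ne_one h1
    have hker : A.mulVec (fun j => (a j).1 ^ q) = 0 := by
      funext i
      simp only [Matrix.mulVec, dotProduct, A, Pi.zero_apply, Finset.sum_mul]
      rw [Finset.sum_comm]
      refine Finset.sum_eq_zero fun t _ => ?_
      have := hDh t
      rw [hzero, iterD_zero] at this
      calc _ = algebraMap k R (Nm i t) * ∑ j, (a j).1 ^ q * G.D^[t] (β j).1 := by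
            rw [Finset.mul_sum]; exact Finset.sum_congr rfl fun j _ => by ring
        _ = 0 := by rw [← this, mul_zero]
    have hz := Matrix.eq_zero_of_mulVec_eq_zero hdet hker
    apply ha0
    funext j
    have := congrFun hz j
    exact Subtype.ext (pow_eq_zero_iff (Fintype.card_ne_zero) |>.1 this)
  have := zero_count G p hp S hS M hM _ h hne hmem hvan
  refine this.trans (le_of_eq ?_)
  ring

lemma weak_weil (r C : ℕ) (hr : 0 < r) (ε : ℝ) (hε : 0 < ε) : ∃ B : ℕ,
    ∀ (k R : Type u) [Field k] [Fintype k] [CommRing R] [IsDomain R] [Algebra k R] (x : R)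
    (G : GoodCurve k R r C x) (p : ℕ) [CharP k p] (_ : p.Prime) (_ : B ≤ p)
    (S : Finset (R →ₐ[k] k)) (_ : ∀ P ∈ S, P (G.D x) ≠ 0),
    (S.card : ℝ) ≤ (1 + ε) * Fintype.card k + B := by
  obtain ⟨M, hM⟩ := exists_nat_gt ((r * C : ℝ) / ε)
  have hM0 : 0 < M := by
    have : (0 : ℝ) < M := lt_of_le_of_lt (by positivity) hM
    exact_mod_cast this
  set l := M / r with hl
  set m := M * (l + M * C) with hm
  refine ⟨M + r * (m + 2 * C) + 1, ?_⟩
  intro k R _ _ _ _ _ x G p _ hp hB S hS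
  have h1 : M < r * (l + 1) := by
    rw [hl]; exact Nat.lt_mul_div_succ M hr
  have h2 : r * l ≤ M := Nat.mul_div_le M r
  have key := stepanov G p hp S hS M l m (by omega) (by nlinarith) (by
    have : (M + 1) * (m + 1) ≤ r * (l + 1) * (m + 1) := Nat.mul_le_mul_right _ h1
    nlinarith)
  have key' : (M : ℝ) * S.card ≤ r * (Fintype.card k * (l + C) + m + 2 * C) := by exact_mod_cast key
  have h2' : (r : ℝ) * l ≤ M := by exact_mod_cast h2
  have hM' : (r * C : ℝ) < M * ε := by rwa [div_lt_iff₀ hε] at hM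
  have hMr : (1 : ℝ) ≤ M := by exact_mod_cast hM0
  have hq : (0 : ℝ) ≤ Fintype.card k := by positivity
  set q : ℝ := (Fintype.card k : ℝ) with hqdef
  have h5 : (0 : ℝ) ≤ r * (m + 2 * C) := by positivity
  have h6 : (M : ℝ) * S.card ≤ M * ((1 + ε) * q + (M + r * (m + 2 * C) + 1)) := by
    calc (M : ℝ) * S.card ≤ q * (r * l + r * C) + r * (m + 2 * C) := by
          refine key'.trans (le_of_eq ?_); ring
      _ ≤ q * (M + M * ε) + M * (r * (m + 2 * C)) := by
          refine add_le_add (mul_le_mul_of_nonneg_left (by linarith) hq) ?_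
          nlinarith
      _ ≤ _ := by nlinarith
  have := le_of_mul_le_mul_left h6 (by linarith)
  push_cast
  exact this

section kummer

variable {k A : Type u} [Field k] [CommRing A] [Algebra k A]

/-- Coefficientwise derivation on polynomials. -/
noncomputable def coefD (D : Derivation k A A) : Derivation k A[X] A[X] :=
  PolynomialModule.equivPolynomialSelf.compDer D.mapCoeffs

lemma coefD_X (D : Derivation k A A) : coefD D X = 0 := by
  simp [coefD]

lemma coefD_C (D : Derivation k A A) (a : A) : coefD D (C a) = C (D a) := by
  ext i
  simp only [coefD, LinearEquiv.compDer]
  change (D.mapCoeffs (C a)).coeff i = _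
  rw [Derivation.mapCoeffs_apply, coeff_C, coeff_C]
  split_ifs <;> simp

/-- The Kummer derivation before descending. -/
noncomputable def kumD0 (d : ℕ) (π : A) (D : Derivation k A A) : Derivation k A[X] A[X] :=
  ((d : A[X]) * X ^ (d - 1)) • coefD D +
    C (D π) • (Polynomial.derivative' (R := A)).restrictScalars k

lemma kumD0_C (d : ℕ) (π a : A) (D : Derivation k A A) :
    kumD0 d π D (C a) = (d : A[X]) * X ^ (d - 1) * C (D a) := by
  simp [kumD0, coefD_C]

lemma kumD0_X (d : ℕ) (π : A) (D : Derivation k A A) :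
    kumD0 d π D X = C (D π) := by
  simp [kumD0, coefD_X]

lemma kumD0_rel (d : ℕ) (π : A) (D : Derivation k A A) :
    kumD0 d π D (X ^ d - C π) = 0 := by
  rw [map_sub, kumD0_C, Derivation.leibniz_pow, kumD0_X]
  simp only [smul_eq_mul, nsmul_eq_mul]
  ring

lemma mk_alg_surj (g : A[X]) :
    Function.Surjective ((AdjoinRoot.mkₐ g).restrictScalars k : A[X] →ₐ[k] AdjoinRoot g) :=
  AdjoinRoot.mk_surjective

lemma kumD0_desc (d : ℕ) (π : A) (D : Derivation k A A) (z : A[X])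
    (hz : ((AdjoinRoot.mkₐ (X ^ d - C π)).restrictScalars k : A[X] →ₐ[k] _) z = 0) :
    ((AdjoinRoot.mkₐ (X ^ d - C π)).restrictScalars k : A[X] →ₐ[k] _) (kumD0 d π D z) = 0 := by
  have hz' : AdjoinRoot.mk (X ^ d - C π) z = 0 := hz
  change AdjoinRoot.mk (X ^ d - C π) _ = 0
  rw [AdjoinRoot.mk_eq_zero] at *
  obtain ⟨w, rfl⟩ := hz'
  rw [Derivation.leibniz, kumD0_rel]
  simp

/-- The Kummer derivation. -/
noncomputable def kumD (d : ℕ) (π : A) (D : Derivation k A A) :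
    Derivation k (AdjoinRoot (X ^ d - C π)) (AdjoinRoot (X ^ d - C π)) :=
  Derivation.liftOfSurjective (mk_alg_surj (k := k) (X ^ d - C π)) (kumD0_desc d π D)

lemma kumD_mk (d : ℕ) (π : A) (D : Derivation k A A) (z : A[X]) :
    kumD d π D (AdjoinRoot.mk _ z) = AdjoinRoot.mk _ (kumD0 d π D z) :=
  Derivation.liftOfSurjective_apply (mk_alg_surj (k := k) (X ^ d - C π)) (kumD0_desc d π D) z

lemma kumD_of (d : ℕ) (π a : A) (D : Derivation k A A) :
    kumD d π D (AdjoinRoot.of _ a) =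
      (d : AdjoinRoot (X ^ d - C π)) * AdjoinRoot.root (X ^ d - C π) ^ (d - 1) * AdjoinRoot.of _ (D a) := by
  have := kumD_mk d π D (C a)
  rw [kumD0_C] at this
  rw [mul_right_comm]
  simpa using this

lemma kumD_root (d : ℕ) (π : A) (D : Derivation k A A) :
    kumD d π D (AdjoinRoot.root _) = AdjoinRoot.of (X ^ d - C π) (D π) := by
  have := kumD_mk d π D X
  rw [kumD0_X] at this
  simpa using this

lemma kum_root_pow (d : ℕ) (π : A) :
    AdjoinRoot.root (X ^ d - C π) ^ d = AdjoinRoot.of (X ^ d - C π) π := by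
  have := AdjoinRoot.eval₂_root (X ^ d - C π)
  simpa [sub_eq_zero] using this

/-- coordinates -/
noncomputable def kumMap (k : Type u) [Field k] [Algebra k A] (d : ℕ) (π : A) :
    (Fin d → A) →ₗ[k] AdjoinRoot (X ^ d - C π) where
  toFun v := ∑ i : Fin d, AdjoinRoot.of _ (v i) * AdjoinRoot.root _ ^ (i : ℕ)
  map_add' v w := by simp [add_mul, Finset.sum_add_distrib]
  map_smul' c v := by
    simp only [Pi.smul_apply, RingHom.id_apply, Finset.smul_sum]
    refine Finset.sum_congr rfl fun i _ => ?_
    rw [← AdjoinRoot.smul_of, smul_mul_assoc]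

lemma kumMap_apply (d : ℕ) (π : A) (v : Fin d → A) : kumMap k d π v =
    ∑ i : Fin d, AdjoinRoot.of _ (v i) * AdjoinRoot.root _ ^ (i : ℕ) := rfl

lemma kumMap_mk (d : ℕ) (π : A) (v : Fin d → A) : kumMap k d π v =
    AdjoinRoot.mk _ (∑ i : Fin d, C (v i) * X ^ (i : ℕ)) := by
  simp [kumMap_apply]

lemma kumMap_bij [Nontrivial A] (d : ℕ) (hd : 0 < d) (π : A) :
    Function.Bijective (kumMap k d π) := by
  have hm : (X ^ d - C π : A[X]).Monic := monic_X_pow_sub_C π hd.ne'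
  have hdeg : (X ^ d - C π : A[X]).natDegree = d := natDegree_X_pow_sub_C
  constructor
  · rw [injective_iff_map_eq_zero]
    intro v hv
    rw [kumMap_mk] at hv
    by_contra hne
    have hdl : (∑ i : Fin d, C (v i) * X ^ (i : ℕ)).degree < (d : WithBot ℕ) := degree_sum_fin_lt v
    have hc : ∀ j : Fin d, (∑ i : Fin d, C (v i) * X ^ (i : ℕ)).coeff j = v j := by
      intro j
      simp [coeff_X_pow, Fin.val_inj]
    refine AdjoinRoot.mk_ne_zero_of_degree_lt hm ?_ ?_ hv
    · intro h0
      apply hne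
      ext j
      rw [← hc j, h0]; simp
    · rw [degree_eq_natDegree hm.ne_zero, hdeg]; exact hdl
  · intro z
    obtain ⟨g, rfl⟩ := AdjoinRoot.mk_surjective z
    refine ⟨fun i => (g %ₘ (X ^ d - C π)).coeff i, ?_⟩
    rw [kumMap_mk]
    have h1 : AdjoinRoot.mk (X ^ d - C π) g = AdjoinRoot.mk (X ^ d - C π) (g %ₘ (X ^ d - C π)) := by
      rw [AdjoinRoot.mk_eq_mk]
      exact ⟨g /ₘ (X ^ d - C π), by
        rw [sub_eq_iff_eq_add, add_comm]; exact (modByMonic_add_div g _).symm⟩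
    rw [h1]
    congr 1
    have h2 : (g %ₘ (X ^ d - C π)).natDegree < d := by
      have := natDegree_modByMonic_lt g hm (by intro h; have := congrArg natDegree h; simp [hdeg] at this; omega)
      rwa [hdeg] at this
    conv_rhs => rw [as_sum_range' _ d h2]
    rw [Finset.sum_range]
    simp [C_mul_X_pow_eq_monomial]

variable {r C₀ : ℕ} {x : A}

/-- the Kummer filtration -/
noncomputable def kumF (G : GoodCurve k A r C₀ x) (d : ℕ) (π : A) (n : ℕ) :
    Submodule k (AdjoinRoot (X ^ d - C π)) :=
  (Submodule.pi Set.univ (fun _ : Fin d => G.F n)).map (kumMap k d π)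

lemma mem_kumF (G : GoodCurve k A r C₀ x) (d : ℕ) (π : A) (n : ℕ) (i : ℕ) (hi : i < d) (a : A)
    (ha : a ∈ G.F n) : AdjoinRoot.of _ a * AdjoinRoot.root _ ^ i ∈ kumF G d π n := by
  classical
  refine ⟨Pi.single ⟨i, hi⟩ a, ?_, ?_⟩
  · intro j _
    by_cases h : j = ⟨i, hi⟩
    · subst h; simpa using ha
    · simp [h]
  · rw [kumMap_apply, Finset.sum_eq_single ⟨i, hi⟩]
    · simp
    · intro b _ hb; simp [hb]
    · simp

lemma kumF_mono (G : GoodCurve k A r C₀ x) (d : ℕ) (π : A) : Monotone (kumF G d π) := by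
  intro m n h
  refine Submodule.map_mono ?_
  intro v hv i hi
  exact G.mono h (hv i hi)

lemma mem_kumF2 (G : GoodCurve k A r C₀ x) (d : ℕ) (π : A) (e : ℕ) (hπ : π ∈ G.F e)
    (n : ℕ) (i : ℕ) (hi : i + 1 < 2 * d) (a : A)
    (ha : a ∈ G.F n) : AdjoinRoot.of _ a * AdjoinRoot.root _ ^ i ∈ kumF G d π (n + e + C₀) := by
  by_cases h : i < d
  · exact mem_kumF G d π _ i h a (G.mono (by omega) ha)
  · obtain ⟨j, rfl⟩ := Nat.exists_eq_add_of_le (not_lt.1 h)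
    rw [pow_add, kum_root_pow, ← mul_assoc, ← map_mul]
    exact mem_kumF G d π _ j (by omega) _ (G.mul_mem _ _ _ _ ha hπ)

lemma kumF_induction (G : GoodCurve k A r C₀ x) (d : ℕ) (π : A) (n : ℕ)
    (S : Submodule k (AdjoinRoot (X ^ d - C π)))
    (T : AdjoinRoot (X ^ d - C π) →ₗ[k] AdjoinRoot (X ^ d - C π))
    (h : ∀ i < d, ∀ a ∈ G.F n, T (AdjoinRoot.of _ a * AdjoinRoot.root _ ^ i) ∈ S)
    (z) (hz : z ∈ kumF G d π n) : T z ∈ S := by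
  obtain ⟨v, hv, rfl⟩ := hz
  rw [kumMap_apply, map_sum]
  exact Submodule.sum_mem _ fun i _ => h i i.2 _ (hv i trivial)

/-- Power of a submodule as a submodule of the product. -/
def piConstEquiv (d : ℕ) (p : Submodule k A) :
    (Submodule.pi Set.univ (fun _ : Fin d => p)) ≃ₗ[k] (Fin d → p) where
  toFun v i := ⟨v.1 i, v.2 i trivial⟩
  invFun w := ⟨fun i => (w i).1, fun i _ => (w i).2⟩
  map_add' _ _ := rfl
  map_smul' _ _ := rfl
  left_inv _ := rfl
  right_inv _ := rfl

/-- The Kummer step. -/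
noncomputable def kummerStep [Nontrivial A] (G : GoodCurve k A r C₀ x) (d : ℕ) (hd : 0 < d)
    (π : A) (e : ℕ) (hπ : π ∈ G.F e) :
    GoodCurve k (AdjoinRoot (X ^ d - C π)) (r * d) (2 * C₀ + e) (AdjoinRoot.of _ x) where
  F := kumF G d π
  mono := kumF_mono G d π
  poly_mem p n hp := by
    have h1 : aeval (AdjoinRoot.of (X ^ d - C π) x) p = AdjoinRoot.of _ (aeval x p) := by
      have := aeval_algHom_apply (AdjoinRoot.ofAlgHom k (X ^ d - C π)) x p
      simpa using this
    rw [h1]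
    have := mem_kumF G d π n 0 hd _ (G.poly_mem p n hp)
    simpa using this
  mul_mem i j a b ha hb := by
    refine kumF_induction G d π i _ (LinearMap.mulRight k b) ?_ a ha
    intro i' hi' a' ha'
    refine kumF_induction G d π j _
      (LinearMap.mulLeft k (AdjoinRoot.of _ a' * AdjoinRoot.root _ ^ i')) ?_ b hb
    intro j' hj' b' hb'
    simp only [LinearMap.mulLeft_apply]
    have := mem_kumF2 G d π e hπ _ (i' + j') (by omega) (a' * b') (G.mul_mem _ _ _ _ ha' hb')
    rw [map_mul, pow_add] at this
    rw [mul_mul_mul_comm]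
    exact kumF_mono G d π (by omega) this
  fin n := by
    have := G.fin n
    have := Module.Finite.equiv (piConstEquiv d (G.F n)).symm
    exact Module.Finite.map _ _
  rank n := by
    rw [kumF, LinearEquiv.finrank_eq (Submodule.equivMapOfInjective _ (kumMap_bij d hd π).1 _).symm]
    have := G.fin n
    rw [(piConstEquiv d (G.F n)).finrank_eq, Module.finrank_pi_fintype]
    simp [G.rank]
    ring
  exh z := by
    obtain ⟨v, rfl⟩ := (kumMap_bij (k := k) d hd π).2 z
    choose N hN using fun i => G.exh (v i)
    refine ⟨Finset.univ.sup N, v, fun i _ => G.mono (Finset.le_sup (Finset.mem_univ i)) (hN i), rfl⟩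
  D := kumD d π G.D
  D_mem n a ha := by
    refine kumF_induction G d π n _ (kumD d π G.D).toLinearMap ?_ a ha
    intro i hi b hb
    change kumD d π G.D _ ∈ _
    rw [Derivation.leibniz, Derivation.leibniz_pow, kumD_of, kumD_root]
    refine Submodule.add_mem _ ?_ ?_
    · rcases Nat.eq_zero_or_pos i with rfl | hi0
      · simp
      have := mem_kumF G d π _ (i - 1) (by omega) _ (G.mul_mem _ _ _ _ hb (G.D_mem _ _ hπ))
      rw [map_mul] at this
      have h2 := Submodule.smul_of_tower_mem _ (i : ℕ) (kumF_mono G d π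
        (show n + (e + C₀) + C₀ ≤ n + (2 * C₀ + e) by omega) this)
      convert h2 using 1
      simp only [smul_eq_mul, nsmul_eq_mul]
      ring
    · have := mem_kumF2 G d π e hπ _ (i + (d - 1)) (by omega) _ (G.D_mem _ _ hb)
      have h2 := Submodule.smul_of_tower_mem _ (d : ℕ) (kumF_mono G d π
        (show n + C₀ + e + C₀ ≤ n + (2 * C₀ + e) by omega) this)
      convert h2 using 1
      simp only [smul_eq_mul, nsmul_eq_mul]
      ring

lemma kummerStep_F [Nontrivial A] (G : GoodCurve k A r C₀ x) (d : ℕ) (hd : 0 < d)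
    (π : A) (e : ℕ) (hπ : π ∈ G.F e) : (kummerStep G d hd π e hπ).F = kumF G d π := rfl

lemma kummerStep_D [Nontrivial A] (G : GoodCurve k A r C₀ x) (d : ℕ) (hd : 0 < d)
    (π : A) (e : ℕ) (hπ : π ∈ G.F e) : (kummerStep G d hd π e hπ).D = kumD d π G.D := rfl

/-- The affine line. -/
noncomputable def lineCurve (k : Type u) [Field k] (C₀ : ℕ) : GoodCurve k k[X] 1 C₀ X where
  F n := degreeLT k (n + 1)
  mono m n h := degreeLT_mono (by omega)
  poly_mem p n h := by
    rw [aeval_X_left_apply, mem_degreeLT]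
    exact lt_of_le_of_lt (degree_le_of_natDegree_le h) (by exact_mod_cast Nat.lt_succ_self n)
  mul_mem i j a b ha hb := by
    have key : ∀ (m : ℕ) (q : k[X]), q ∈ degreeLT k (m + 1) ↔ q.natDegree ≤ m := by
      intro m q
      rw [mem_degreeLT, natDegree_le_iff_degree_le]
      exact Order.lt_succ_iff (a := q.degree) (b := (m : WithBot ℕ))
    rw [key] at *
    refine natDegree_mul_le.trans ?_
    omega
  fin n := Module.Finite.equiv (degreeLTEquiv k (n + 1)).symm
  rank n := by
    rw [(degreeLTEquiv k (n + 1)).finrank_eq]; simp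
  exh a := ⟨a.natDegree, by
    rw [mem_degreeLT]
    exact lt_of_le_of_lt degree_le_natDegree (by exact_mod_cast Nat.lt_succ_self _)⟩
  D := Polynomial.derivative'
  D_mem n a ha := by
    rw [mem_degreeLT] at *
    change (derivative a).degree < _
    exact lt_of_le_of_lt (degree_derivative_le) (lt_of_lt_of_le ha (by exact_mod_cast (by omega)))

end kummer

section kummerDomain

variable {A : Type u} [CommRing A] [IsDomain A] [IsNoetherianRing A]

lemma kummer_prime (d : ℕ) (hd : 0 < d) (π : A) (hπ0 : π ≠ 0) (P : Ideal A) [P.IsPrime]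
    (hπ : π ∈ P) (hP : ∀ t ∈ P, ∃ s, s ∉ P ∧ ∃ v, s * t = v * π) :
    Prime (X ^ d - C π : A[X]) := by
  let L := Localization.AtPrime P
  have hinj : Function.Injective (algebraMap A L) :=
    IsLocalization.injective L P.primeCompl_le_nonZeroDivisors
  have hmax : IsLocalRing.maximalIdeal L = Ideal.span {algebraMap A L π} := by
    rw [← Localization.AtPrime.map_eq_maximalIdeal]
    apply le_antisymm
    · rw [Ideal.map_le_iff_le_comap]
      intro t ht
      obtain ⟨s, hs, v, hv⟩ := hP t ht
      rw [Ideal.mem_comap, Ideal.mem_span_singleton]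
      have hu : IsUnit (algebraMap A L s) := IsLocalization.map_units L (⟨s, hs⟩ : P.primeCompl)
      rw [← hu.dvd_mul_left, ← map_mul, hv, map_mul]
      exact Dvd.intro_left _ rfl
    · rw [Ideal.span_singleton_le_iff_mem]
      exact Ideal.mem_map_of_mem _ hπ
  have : IsNoetherianRing L := IsLocalization.isNoetherianRing P.primeCompl L inferInstance
  have hpid : IsPrincipalIdealRing L :=
    ((tfae_of_isNoetherianRing_of_isLocalRing_of_isDomain L).out 0 4 :
      IsPrincipalIdealRing L ↔ (IsLocalRing.maximalIdeal L).IsPrincipal).2 ⟨⟨_, hmax⟩⟩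
  have hm : (X ^ d - C (algebraMap A L π) : L[X]).Monic := monic_X_pow_sub_C _ hd.ne'
  have hdeg : (X ^ d - C (algebraMap A L π) : L[X]).natDegree = d := natDegree_X_pow_sub_C
  have hπL : algebraMap A L π ≠ 0 := by simpa using (map_ne_zero_iff _ hinj).2 hπ0
  have hE : (X ^ d - C (algebraMap A L π) : L[X]).IsEisensteinAt (IsLocalRing.maximalIdeal L) := by
    refine ⟨?_, ?_, ?_⟩
    · rw [hm.leadingCoeff]
      exact fun h => (IsLocalRing.maximalIdeal.isMaximal L).ne_top ((Ideal.eq_top_iff_one _).2 h)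
    · intro n hn
      rw [hdeg] at hn
      rw [coeff_sub, coeff_X_pow, if_neg hn.ne, zero_sub, coeff_C, hmax]
      split_ifs
      · exact neg_mem (Ideal.mem_span_singleton_self _)
      · simp
    · rw [coeff_sub, coeff_X_pow, if_neg hd.ne, zero_sub, coeff_C, if_pos rfl, hmax,
        Ideal.span_singleton_pow, neg_mem_iff, Ideal.mem_span_singleton]
      rintro ⟨w, hw⟩
      have h1 : algebraMap A L π * w = 1 := by
        apply mul_left_cancel₀ hπL
        rw [mul_one]
        conv_rhs => rw [hw]
        ring
      have h2 : IsUnit (algebraMap A L π) := IsUnit.of_mul_eq_one _ h1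
      have h3 : algebraMap A L π ∈ IsLocalRing.maximalIdeal L := by
        rw [hmax]; exact Ideal.mem_span_singleton_self _
      exact (IsLocalRing.mem_maximalIdeal _).1 h3 h2
  have hirr : Irreducible (X ^ d - C (algebraMap A L π) : L[X]) :=
    hE.irreducible inferInstance hm.isPrimitive (by rw [hdeg]; exact hd)
  have hprime : Prime (X ^ d - C (algebraMap A L π) : L[X]) := hirr.prime
  have hmap : (X ^ d - C π : A[X]).map (algebraMap A L) = X ^ d - C (algebraMap A L π) := by simp
  have hmA : (X ^ d - C π : A[X]).Monic := monic_X_pow_sub_C _ hd.ne'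
  refine ⟨hmA.ne_zero, ?_, ?_⟩
  · intro hu
    apply hprime.not_isUnit
    rw [← hmap]
    exact hu.map (mapRingHom (algebraMap A L))
  · intro a b hab
    rw [← map_dvd_map _ hinj hmA, ← map_dvd_map _ hinj hmA, hmap]
    rw [← map_dvd_map _ hinj hmA, hmap, Polynomial.map_mul] at hab
    exact hprime.dvd_or_dvd hab

/-- The prime condition from unramifiedness of the quotient. -/
lemma kummer_prime' (k : Type u) [Field k] [Algebra k A] [Algebra.FiniteType k A]
    (d : ℕ) (hd : 0 < d) (π : A) (hπ0 : π ≠ 0) (P : Ideal A) [P.IsPrime]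
    (hπ : π ∈ P) (hΩ : Subsingleton (Ω[A ⧸ Ideal.span {π}⁄k])) :
    Prime (X ^ d - C π : A[X]) := by
  let S := A ⧸ Ideal.span {π}
  have hU : Algebra.FormallyUnramified k S := ⟨hΩ⟩
  have hft : Algebra.FiniteType k S :=
    Algebra.FiniteType.of_surjective (Ideal.Quotient.mkₐ k (Ideal.span {π})) Ideal.Quotient.mk_surjective
  have hred : IsReduced S := Algebra.FormallyUnramified.isReduced_of_field k S
  have hfin : Module.Finite k S := Algebra.FormallyUnramified.finite_of_free k S
  have hart : IsArtinianRing S := IsArtinianRing.of_finite k S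
  refine kummer_prime d hd π hπ0 P hπ fun t ht => ?_
  obtain ⟨n, y, hy⟩ := IsArtinian.exists_pow_succ_smul_dvd (R := S) (M := S)
    (Ideal.Quotient.mk _ t) 1
  obtain ⟨v, hv⟩ := Ideal.Quotient.mk_surjective y
  refine ⟨1 - t * v, ?_, ?_⟩
  · intro h
    exact ‹P.IsPrime›.ne_top ((Ideal.eq_top_iff_one _).2
      (by simpa using P.add_mem h (P.mul_mem_right v ht)))
  · have h0 : Ideal.Quotient.mk (Ideal.span {π}) ((1 - t * v) * t) = 0 := by
      have : IsNilpotent (Ideal.Quotient.mk (Ideal.span {π}) ((1 - t * v) * t)) := by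
        refine ⟨n + 1, ?_⟩
        rw [map_mul, map_sub, map_mul, map_one, hv, mul_pow, pow_succ (1 - _)]
        simp only [smul_eq_mul, Nat.succ_eq_add_one] at hy
        have : (1 - Ideal.Quotient.mk (Ideal.span {π}) t * y) *
          Ideal.Quotient.mk (Ideal.span {π}) t ^ n = 0 := by
          linear_combination (-1) * hy
        rw [pow_succ]
        linear_combination ((1 - Ideal.Quotient.mk (Ideal.span {π}) t * y) ^ n *
          Ideal.Quotient.mk (Ideal.span {π}) t) * this
      exact hred.eq_zero _ this
    rw [Ideal.Quotient.eq_zero_iff_mem, Ideal.mem_span_singleton] at h0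
    obtain ⟨w, hw⟩ := h0
    exact ⟨w, by rw [hw, mul_comm]⟩

end kummerDomain

section tower

/-- iteration of `u ↦ u^d + c` on a `k`-algebra -/
def fit {k : Type u} [Field k] (d : ℕ) (c : k) (L : Type u) [CommRing L] [Algebra k L] (n : ℕ) :
    L → L := (fun u => u ^ d + algebraMap k L c)^[n]

section fit
variable {k : Type u} [Field k] {d : ℕ} {c : k} {L : Type u} [CommRing L] [Algebra k L]

lemma fit_zero (u : L) : fit d c L 0 u = u := rfl

lemma fit_succ (n : ℕ) (u : L) :
    fit d c L (n + 1) u = fit d c L n (u ^ d + algebraMap k L c) := rfl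

lemma fit_succ' (n : ℕ) (u : L) :
    fit d c L (n + 1) u = (fit d c L n u) ^ d + algebraMap k L c := by
  rw [fit, Function.iterate_succ_apply']; rfl

lemma fit_add (m n : ℕ) (u : L) : fit d c L (m + n) u = fit d c L m (fit d c L n u) :=
  Function.iterate_add_apply _ m n u

lemma map_fit {M : Type u} [CommRing M] [Algebra k M] (φ : L →ₐ[k] M) (n : ℕ) (u : L) :
    φ (fit d c L n u) = fit d c M n (φ u) := by
  induction n with
  | zero => rfl
  | succ n ih => rw [fit_succ', fit_succ', map_add, map_pow, ih, AlgHom.commutes]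

lemma algebraMap_fit (n : ℕ) (u : k) :
    algebraMap k L (fit d c k n u) = fit d c L n (algebraMap k L u) :=
  map_fit (Algebra.ofId k L) n u

lemma dvd_fit_sub (n : ℕ) (u v : L) : u - v ∣ fit d c L n u - fit d c L n v := by
  induction n with
  | zero => exact dvd_rfl
  | succ n ih =>
    rw [fit_succ', fit_succ', add_sub_add_right_eq_sub]
    exact ih.trans (sub_dvd_pow_sub_pow _ _ d)

lemma fit_surj {L : Type u} [Field L] [Algebra k L] [IsAlgClosed L] (hd : 0 < d) (n : ℕ) (v : L) :
    ∃ u, fit d c L n u = v := by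
  induction n generalizing v with
  | zero => exact ⟨v, rfl⟩
  | succ n ih =>
    obtain ⟨w, hw⟩ := IsAlgClosed.exists_pow_nat_eq (v - algebraMap k L c) hd
    obtain ⟨u, hu⟩ := ih w
    exact ⟨u, by rw [fit_succ', hu, hw]; ring⟩

/-- noncritical values force differentials to vanish -/
lemma der_zero_of_fit (hdk : (d : k) ≠ 0) {M : Type*} [AddCommGroup M] [Module L M] [Module k M]
    (D : Derivation k L M) (n : ℕ) (w : L) (v : k) (hw : fit d c L n w = algebraMap k L v)
    (hv : ∀ s, 1 ≤ s → s ≤ n → v ≠ fit d c k s 0) : D w = 0 := by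
  induction n generalizing w with
  | zero =>
    rw [fit_zero] at hw
    rw [hw, Derivation.map_algebraMap]
  | succ n ih =>
    have h1 := ih (w ^ d + algebraMap k L c) hw (fun s h1 h2 => hv s h1 (by omega))
    have hu : IsUnit w := by
      have h2 := dvd_fit_sub (d := d) (c := c) (n + 1) w 0
      rw [hw, sub_zero, ← map_zero (algebraMap k L), ← algebraMap_fit, ← map_sub] at h2
      refine isUnit_of_dvd_unit h2 (IsUnit.map (algebraMap k L) ?_)
      exact isUnit_iff_ne_zero.2 (sub_ne_zero.2 (hv _ (by omega) le_rfl))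
    rw [map_add, Derivation.map_algebraMap, add_zero, Derivation.leibniz_pow] at h1
    have h3 : IsUnit ((d : L) * w ^ (d - 1)) := by
      refine IsUnit.mul ?_ (hu.pow _)
      rw [← map_natCast (algebraMap k L)]
      exact IsUnit.map _ (isUnit_iff_ne_zero.2 hdk)
    rw [← Nat.cast_smul_eq_nsmul L, smul_smul] at h1
    exact (h3.smul_eq_zero).1 h1

end fit

/-- A relation in three unknowns over all `k`-algebras. -/
abbrev RelT (k : Type u) [Field k] : Type (u + 1) :=
  ∀ (L : Type u) [CommRing L] [Algebra k L], L → L → L → Prop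

/-- the curve defined by `Rel` has a good integral coordinate ring -/
def Tower (k : Type u) [Field k] (Rel : RelT k) (Bad : k → k → k → Prop) (r C₀ e : ℕ) : Prop :=
  ∃ (A : Type u) (_ : CommRing A) (_ : IsDomain A) (_ : Algebra k A) (x y z : A)
    (G : GoodCurve k A r C₀ x),
    Algebra.adjoin k {x, y, z} = ⊤ ∧
    Function.Injective (aeval x : k[X] →ₐ[k] A) ∧
    (∀ (B : Type u) [CommRing B] [Algebra k B] (φ : A →ₐ[k] B), Rel B (φ x) (φ y) (φ z)) ∧
    (∀ (B : Type u) [CommRing B] [Algebra k B] (x₀ y₀ z₀ : B), Rel B x₀ y₀ z₀ →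
      ∃ φ : A →ₐ[k] B, φ x = x₀ ∧ φ y = y₀ ∧ φ z = z₀) ∧
    y ∈ G.F e ∧ z ∈ G.F e ∧
    (∀ P : A →ₐ[k] k, ¬ Bad (P x) (P y) (P z) → P (G.D x) ≠ 0)

variable {k : Type u} [Field k]

lemma Tower.congr {Rel Rel' : RelT k} {Bad Bad' : k → k → k → Prop} {r C₀ e : ℕ}
    (h : Tower k Rel Bad r C₀ e)
    (h1 : ∀ (B : Type u) [CommRing B] [Algebra k B] (x y z : B), Rel B x y z ↔ Rel' B x y z)
    (h2 : ∀ x y z, Bad x y z → Bad' x y z) : Tower k Rel' Bad' r C₀ e := by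
  obtain ⟨A, i1, i2, i3, x, y, z, G, a1, a2, a3, a4, a5, a6, a7⟩ := h
  refine ⟨A, i1, i2, i3, x, y, z, G, a1, a2, ?_, ?_, a5, a6, ?_⟩
  · intro B _ _ φ
    exact (h1 _ _ _ _).1 (a3 B φ)
  · intro B _ _ x0 y0 z0 h
    exact a4 B x0 y0 z0 ((h1 _ _ _ _).2 h)
  · intro P hP
    exact a7 P (fun h => hP (h2 _ _ _ h))

lemma Tower.swap {Rel : RelT k} {Bad : k → k → k → Prop} {r C₀ e : ℕ}
    (h : Tower k Rel Bad r C₀ e) :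
    Tower k (fun L _ _ x y z => Rel L x z y) (fun x y z => Bad x z y) r C₀ e := by
  obtain ⟨A, i1, i2, i3, x, y, z, G, a1, a2, a3, a4, a5, a6, a7⟩ := h
  refine ⟨A, i1, i2, i3, x, z, y, G, ?_, a2, a3, ?_, a6, a5, a7⟩
  · rw [← a1, Set.pair_comm]
  · intro B _ _ x0 y0 z0 h
    obtain ⟨φ, h1, h2, h3⟩ := a4 B x0 z0 y0 h
    exact ⟨φ, h1, h3, h2⟩

lemma Tower.step {Rel : RelT k} {Bad : k → k → k → Prop} {r C₀ e : ℕ}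
    (h : Tower k Rel Bad r C₀ e) (d : ℕ) (hd : 2 ≤ d) (hdk : (d : k) ≠ 0) (b c : k) (hb : b ≠ 0)
    (hΩ : ∀ (S : Type u) [CommRing S] [Algebra k S] (x z : S), Rel S x (algebraMap k S c) z →
      KaehlerDifferential.D k S x = 0 ∧ KaehlerDifferential.D k S z = 0)
    (hpt : ∃ x₀ z₀ : AlgebraicClosure k, Rel _ x₀ (algebraMap k _ c) z₀)
    (htr : ∃ g : k[X], g ≠ 0 ∧ ∀ (S : Type u) [CommRing S] [Algebra k S] (x z : S),
      Rel S x (algebraMap k S c) z → aeval x g = 0) :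
    Tower k (fun L _ _ x w z => Rel L x (algebraMap k L b * w ^ d + algebraMap k L c) z)
      (fun x w z => w = 0 ∨ Bad x (b * w ^ d + c) z) (r * d) (2 * C₀ + e) e := by
  obtain ⟨A, i1, i2, i3, x, y, z, G, a1, a2, a3, a4, a5, a6, a7⟩ := h
  have hft : Algebra.FiniteType k A := by
    classical exact ⟨⟨{x, y, z}, by simpa using a1⟩⟩
  have hN : IsNoetherianRing A := Algebra.FiniteType.isNoetherianRing k A
  let π : A := b⁻¹ • (y - algebraMap k A c)
  have hyπ : y = algebraMap k A b * π + algebraMap k A c := by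
    simp only [π, Algebra.smul_def]
    rw [← mul_assoc, ← map_mul, mul_inv_cancel₀ hb]; simp
  have h1e : ∀ n, algebraMap k A c ∈ G.F n := fun n => by
    have := G.poly_mem (C c) n (by simp)
    simpa using this
  have h1e' : ∀ n, (1 : A) ∈ G.F n := fun n => by
    have := G.poly_mem 1 n (by simp)
    simpa using this
  have hπe : π ∈ G.F e := Submodule.smul_mem _ _ (Submodule.sub_mem _ a5 (h1e e))
  have hπ0 : π ≠ 0 := by
    intro h0
    obtain ⟨g, hg0, hg⟩ := htr
    have h1 := a3 A (AlgHom.id k A)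
    simp only [AlgHom.id_apply] at h1
    rw [hyπ, h0, mul_zero, zero_add] at h1
    have h2 := hg A _ _ h1
    exact hg0 (a2 (by rw [h2, map_zero]))
  obtain ⟨x₀, z₀, h0⟩ := hpt
  obtain ⟨φ, hφ1, hφ2, hφ3⟩ := a4 _ _ _ _ h0
  have hφπ : φ π = 0 := by simp [π, hφ2]
  have hprime : (RingHom.ker φ).IsPrime := RingHom.ker_isPrime φ
  have hsub : Subsingleton (Ω[A ⧸ Ideal.span {π}⁄k]) := by
    let q := Ideal.Quotient.mkₐ k (Ideal.span {π})
    have hq : q π = 0 := by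
      simp only [q, Ideal.Quotient.mkₐ_eq_mk, Ideal.Quotient.eq_zero_iff_mem]
      exact Ideal.mem_span_singleton_self _
    have h1 := a3 _ q
    have hqy : q y = algebraMap k _ c := by
      rw [hyπ, map_add, map_mul, hq, mul_zero, zero_add, AlgHom.commutes]
    rw [hqy] at h1
    obtain ⟨h2, h3⟩ := hΩ _ _ _ h1
    have htop : Algebra.adjoin k {q x, q y, q z} = ⊤ := by
      have := congrArg (Subalgebra.map q) a1
      rw [AlgHom.map_adjoin, Algebra.map_top, (AlgHom.range_eq_top q).2 Ideal.Quotient.mk_surjective] at this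
      rw [← this]
      congr 1
      simp [Set.image_insert_eq]
    have hD : ∀ s, KaehlerDifferential.D k (A ⧸ Ideal.span {π}) s = 0 := by
      have h4 : Set.EqOn (KaehlerDifferential.D k (A ⧸ Ideal.span {π})) (0 : Derivation k _ _)
          {q x, q y, q z} := by
        rintro s (rfl | rfl | rfl)
        · simpa using h2
        · rw [hqy, Derivation.map_algebraMap]; simp
        · simpa using h3
      intro s
      have := Derivation.eqOn_adjoin h4 (x := s) (by rw [htop]; trivial)
      simpa using this
    rw [← not_nontrivial_iff_subsingleton]
    intro hnt
    have h5 := KaehlerDifferential.span_range_derivation k (A ⧸ Ideal.span {π})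
    have h6 : Set.range (KaehlerDifferential.D k (A ⧸ Ideal.span {π})) ⊆ {0} := by
      rintro _ ⟨s, rfl⟩; exact hD s
    have h7 := Submodule.span_mono (R := A ⧸ Ideal.span {π}) h6
    rw [h5, Submodule.span_zero_singleton, top_le_iff] at h7
    exact bot_ne_top h7
  have hpr := kummer_prime' k d (by omega) π hπ0 (RingHom.ker φ) hφπ hsub
  have hdom : IsDomain (AdjoinRoot (X ^ d - C π)) := AdjoinRoot.isDomain_of_prime hpr
  have hdeg : (X ^ d - C π : A[X]).degree ≠ 0 := by
    rw [degree_X_pow_sub_C (by omega)]; exact_mod_cast (by omega)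
  have hofinj : Function.Injective (AdjoinRoot.of (X ^ d - C π)) :=
    AdjoinRoot.of.injective_of_degree_ne_zero hdeg
  let of' : A →ₐ[k] AdjoinRoot (X ^ d - C π) := AdjoinRoot.ofAlgHom k (X ^ d - C π)
  have hof : ∀ a, of' a = AdjoinRoot.of (X ^ d - C π) a := fun a => rfl
  have hoy : of' y = algebraMap k _ b * AdjoinRoot.root (X ^ d - C π) ^ d + algebraMap k _ c := by
    rw [kum_root_pow, hyπ, map_add, map_mul, AlgHom.commutes, AlgHom.commutes]; rfl
  refine ⟨AdjoinRoot (X ^ d - C π), inferInstance, hdom, inferInstance, of' x,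
    AdjoinRoot.root _, of' z, kummerStep G d (by omega) π e hπe, ?_, ?_, ?_, ?_, ?_, ?_, ?_⟩
  · rw [eq_top_iff]
    set U := Algebra.adjoin k {of' x, AdjoinRoot.root (X ^ d - C π), of' z} with hU
    have hr : AdjoinRoot.root (X ^ d - C π) ∈ U := Algebra.subset_adjoin (by simp)
    have hy : of' y ∈ U := by
      rw [hoy]
      exact U.add_mem (U.mul_mem (U.algebraMap_mem b) (U.pow_mem hr d)) (U.algebraMap_mem c)
    have hA : ∀ a, of' a ∈ U := by
      intro a
      have : a ∈ Algebra.adjoin k {x, y, z} := by rw [a1]; trivial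
      have h2 : Algebra.adjoin k {x, y, z} ≤ U.comap of' := by
        rw [Algebra.adjoin_le_iff]
        rintro s (rfl | rfl | rfl)
        · exact Algebra.subset_adjoin (by simp)
        · exact hy
        · exact Algebra.subset_adjoin (by simp)
      exact h2 this
    intro w _
    obtain ⟨v, rfl⟩ := (kumMap_bij (k := k) d (by omega) π).2 w
    rw [kumMap_apply]
    exact U.sum_mem fun i _ => U.mul_mem (hA _) (U.pow_mem hr _)
  · intro p q hpq
    rw [aeval_algHom_apply, aeval_algHom_apply] at hpq
    exact a2 (hofinj hpq)
  · intro B _ _ ψ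
    have h1 := a3 B (ψ.comp of')
    simp only [AlgHom.comp_apply] at h1
    rw [hoy, map_add, map_mul, AlgHom.commutes, AlgHom.commutes, map_pow] at h1
    exact h1
  · intro B _ _ x0 w0 z0 hR
    obtain ⟨ψ, h1, h2, h3⟩ := a4 B _ _ _ hR
    have hψπ : ψ π = w0 ^ d := by
      simp only [π, map_smul, map_sub, h2, AlgHom.commutes, add_sub_cancel_right]
      rw [← Algebra.smul_def, smul_smul, inv_mul_cancel₀ hb, one_smul]
    refine ⟨AdjoinRoot.liftAlgHom _ ψ w0 ?_, ?_, ?_, ?_⟩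
    · rw [eval₂_sub, eval₂_pow, eval₂_X, eval₂_C]
      simp [hψπ]
    · rw [hof]; simp [h1]
    · simp
    · rw [hof]; simp [h3]
  · rw [kummerStep_F]
    have := mem_kumF G d π e 1 (by omega) 1 (h1e' e)
    simpa using this
  · rw [kummerStep_F, hof]
    have := mem_kumF G d π e 0 (by omega) z a6
    simpa using this
  · intro P hP
    push Not at hP
    rw [kummerStep_D, hof, kumD_of, map_mul, map_mul, map_pow, map_natCast]
    refine mul_ne_zero (mul_ne_zero hdk (pow_ne_zero _ hP.1)) ?_
    refine a7 (P.comp of') ?_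
    simp only [AlgHom.comp_apply]
    rw [hoy, map_add, map_mul, AlgHom.commutes, AlgHom.commutes, map_pow]
    exact hP.2

end tower

section tower2

variable {k : Type u} [Field k] {d : ℕ} {c : k}

/-- the basic relation -/
def RelYZ (d : ℕ) (c ζ ζ' : k) (K J i l : ℕ) : RelT k := fun L _ _ x y z =>
  fit d c L i y = algebraMap k L ζ * fit d c L K x ∧
  fit d c L l z = algebraMap k L ζ' * fit d c L J x

/-- bad points -/
def BadYZ (d : ℕ) (c : k) (i l : ℕ) : k → k → k → Prop := fun _ y z =>
  (∃ s < i, fit d c k s y = 0) ∨ (∃ s < l, fit d c k s z = 0)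

lemma natDegree_fit_le (hd : 0 < d) (n : ℕ) : (fit d c k[X] n X).natDegree ≤ d ^ n := by
  induction n with
  | zero => simp [fit_zero]
  | succ n ih =>
    rw [fit_succ', ← C_eq_algebraMap, natDegree_add_C]
    refine natDegree_pow_le.trans ?_
    rw [pow_succ, mul_comm]
    exact Nat.mul_le_mul_right _ ih

lemma tower_base (hd : 0 < d) (ζ ζ' : k) (K J : ℕ) :
    Tower k (RelYZ d c ζ ζ' K J 0 0) (BadYZ d c 0 0) 1 0 (d ^ K + d ^ J) := by
  refine ⟨k[X], inferInstance, inferInstance, inferInstance, X, C ζ * fit d c k[X] K X,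
    C ζ' * fit d c k[X] J X, lineCurve k 0, ?_, ?_, ?_, ?_, ?_, ?_, ?_⟩
  · rw [eq_top_iff, ← Polynomial.adjoin_X]
    exact Algebra.adjoin_mono (by simp)
  · intro p q h
    simpa using h
  · intro B _ _ φ
    refine ⟨?_, ?_⟩
    · rw [fit_zero, map_mul, map_fit, C_eq_algebraMap, AlgHom.commutes]
    · rw [fit_zero, map_mul, map_fit, C_eq_algebraMap, AlgHom.commutes]
  · rintro B _ _ x0 y0 z0 ⟨h1, h2⟩
    refine ⟨aeval x0, by simp, ?_, ?_⟩
    · rw [map_mul, map_fit, C_eq_algebraMap, AlgHom.commutes, aeval_X, ← h1]; rfl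
    · rw [map_mul, map_fit, C_eq_algebraMap, AlgHom.commutes, aeval_X, ← h2]; rfl
  · have := (lineCurve k 0).poly_mem (C ζ * fit d c k[X] K X) (d ^ K + d ^ J)
      ((natDegree_C_mul_le _ _).trans ((natDegree_fit_le hd K).trans (by omega)))
    simpa using this
  · have := (lineCurve k 0).poly_mem (C ζ' * fit d c k[X] J X) (d ^ K + d ^ J)
      ((natDegree_C_mul_le _ _).trans ((natDegree_fit_le hd J).trans (by omega)))
    simpa using this
  · intro P _
    change P (derivative X) ≠ 0
    simp

/-- the orbit of zero is injective up to `N + 1` -/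
def OrbInj (d : ℕ) (c : k) (N : ℕ) : Prop :=
  ∀ a b, a ≤ N + 1 → b ≤ N + 1 → fit d c k a 0 = fit d c k b 0 → a = b

lemma orb_ne {N : ℕ} (h : OrbInj d c N) (hd : 0 < d) {ζ : k} (hζ : ζ ^ d = 1) (hζ1 : ζ ≠ 1)
    {a b : ℕ} (ha1 : 1 ≤ a) (ha : a ≤ N) (hb : b ≤ N) :
    ζ * fit d c k a 0 ≠ fit d c k b 0 := by
  intro h1
  have h2 : fit d c k (a + 1) 0 = fit d c k (b + 1) 0 := by
    rw [fit_succ', fit_succ', ← h1, mul_pow, hζ, one_mul]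
  have h3 := h _ _ (by omega) (by omega) h2
  obtain rfl : a = b := by omega
  have h4 : fit d c k a 0 ≠ 0 := by
    intro h5
    have := h a 0 (by omega) (by omega) (by rw [h5, fit_zero])
    omega
  exact hζ1 (mul_right_cancel₀ h4 (by rw [h1, one_mul]))

lemma fit_c (L : Type u) [CommRing L] [Algebra k L] (hd : 0 < d) (i : ℕ) :
    fit d c L i (algebraMap k L c) = algebraMap k L (fit d c k (i + 1) 0) := by
  rw [fit_succ, algebraMap_fit]
  simp [zero_pow hd.ne']

lemma htr_aux (hd : 0 < d) (K : ℕ) (ζ v : k) (hζ : ζ ≠ 0) :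
    (C ζ * fit d c k[X] K X - C v) ≠ 0 := by
  intro h
  obtain ⟨x₀, hx₀⟩ := fit_surj (k := k) (d := d) (c := c) (L := AlgebraicClosure k) hd K
    (algebraMap k _ (ζ⁻¹ * (v + 1)))
  have := congrArg (aeval x₀) h
  rw [map_sub, map_mul, map_fit, aeval_X, aeval_C, aeval_C, hx₀, ← map_mul, ← map_sub, map_zero,
    map_eq_zero] at this
  rw [mul_inv_cancel_left₀ hζ] at this
  simp at this

lemma tower_ystep (hd : 2 ≤ d) (hdk : (d : k) ≠ 0) {N K J i r C₀ e : ℕ} (hN : OrbInj d c N)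
    {ζ ζ' : k} (hζ : ζ ^ d = 1) (hζ1 : ζ ≠ 1) (hi : i < K) (hK : K ≤ N) (b : k) (hb : b ≠ 0)
    (h : Tower k (RelYZ d c ζ ζ' K J i 0) (BadYZ d c i 0) r C₀ e) :
    Tower k (fun L _ _ x w z => RelYZ d c ζ ζ' K J i 0 L x
      (algebraMap k L b * w ^ d + algebraMap k L c) z)
      (fun x w z => w = 0 ∨ BadYZ d c i 0 x (b * w ^ d + c) z) (r * d) (2 * C₀ + e) e := by
  have hζ0 : ζ ≠ 0 := by rintro rfl; rw [zero_pow (by omega)] at hζ; exact zero_ne_one hζ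
  refine h.step d hd hdk b c hb ?_ ?_ ?_
  · rintro S _ _ x z ⟨h1, h2⟩
    rw [fit_c S (by omega)] at h1
    have hx : KaehlerDifferential.D k S x = 0 := by
      refine der_zero_of_fit (d := d) (c := c) hdk _ K x (ζ⁻¹ * fit d c k (i + 1) 0) ?_ ?_
      · rw [map_mul, h1, ← mul_assoc, ← map_mul, inv_mul_cancel₀ hζ0]; simp
      · intro s hs1 hs2
        exact orb_ne hN (by omega) (by rw [inv_pow, hζ, inv_one]) (by simpa using hζ1) (by omega)
          (by omega) (by omega)
    refine ⟨hx, ?_⟩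
    rw [fit_zero] at h2
    rw [h2]
    have : ∀ n, KaehlerDifferential.D k S (fit d c S n x) = 0 := by
      intro n
      induction n with
      | zero => exact hx
      | succ n ih => rw [fit_succ', map_add, Derivation.leibniz_pow, ih]; simp
    rw [Derivation.leibniz, this, Derivation.map_algebraMap]; simp
  · obtain ⟨x₀, hx₀⟩ := fit_surj (k := k) (d := d) (c := c) (L := AlgebraicClosure k) (by omega) K
      (algebraMap k _ (ζ⁻¹ * fit d c k (i + 1) 0))
    refine ⟨x₀, algebraMap k _ ζ' * fit d c _ J x₀, ?_, rfl⟩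
    rw [fit_c _ (by omega), hx₀, ← map_mul, mul_inv_cancel_left₀ hζ0]
  · refine ⟨_, htr_aux (c := c) (d := d) (by omega) K ζ (fit d c k (i + 1) 0) hζ0, ?_⟩
    rintro S _ _ x z ⟨h1, -⟩
    rw [fit_c S (by omega)] at h1
    rw [map_sub, map_mul, map_fit, aeval_X, aeval_C, aeval_C, h1, sub_self]

lemma tower_y (d K J i : ℕ) (hd : 2 ≤ d) : ∃ r C₀ e : ℕ, 0 < r ∧ ∀ (k : Type u) [Field k] (c ζ ζ' : k) (N : ℕ),
    (d : k) ≠ 0 → OrbInj d c N → ζ ^ d = 1 → ζ ≠ 1 → i ≤ K → K ≤ N →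
    Tower k (RelYZ d c ζ ζ' K J i 0) (BadYZ d c i 0) r C₀ e := by
  induction i with
  | zero => exact ⟨1, 0, _, one_pos, fun k _ c ζ ζ' N _ _ _ _ _ _ => tower_base (by omega) ζ ζ' K J⟩
  | succ i ih =>
    obtain ⟨r, C₀, e, hr, ih⟩ := ih
    refine ⟨r * d, 2 * C₀ + e, e, by positivity, fun k _ c ζ ζ' N h1 h2 h3 h4 h5 h6 => ?_⟩
    refine (tower_ystep hd h1 h2 h3 h4 (by omega) h6 1 one_ne_zero
      (ih k c ζ ζ' N h1 h2 h3 h4 (by omega) h6)).congr ?_ ?_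
    · intro B _ _ x y z
      simp only [RelYZ, map_one, one_mul]
      rfl
    · rintro x y z (rfl | ⟨s, hs, h⟩ | ⟨s, hs, h⟩)
      · exact Or.inl ⟨0, by omega, rfl⟩
      · refine Or.inl ⟨s + 1, by omega, ?_⟩
        rw [one_mul] at h
        exact h
      · omega

lemma fit_root {L : Type u} [CommRing L] [Algebra k L] {ζ : k} (hζ : ζ ^ d = 1) (n : ℕ) (hn : 1 ≤ n)
    (u : L) : fit d c L n (algebraMap k L ζ * u) = fit d c L n u := by
  obtain ⟨m, rfl⟩ : ∃ m, n = m + 1 := ⟨n - 1, by omega⟩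
  rw [fit_succ, fit_succ, mul_pow, ← map_pow, hζ, map_one, one_mul]

lemma tower_z (d K J l : ℕ) (hd : 2 ≤ d) (hJ : J < K) : ∃ r C₀ e : ℕ, 0 < r ∧ ∀ (k : Type u) [Field k] (c ζ ζ' : k) (N : ℕ),
    (d : k) ≠ 0 → OrbInj d c N → ζ ^ d = 1 → ζ ≠ 1 → ζ' ^ d = 1 → ζ' ≠ 1 → l ≤ J → K ≤ N →
    Tower k (RelYZ d c ζ ζ' K J K l) (BadYZ d c K l) r C₀ e := by
  induction l with
  | zero =>
    obtain ⟨r, C₀, e, hr, h⟩ := tower_y d K J K hd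
    exact ⟨r, C₀, e, hr, fun k _ c ζ ζ' N h1 h2 h3 h4 _ _ _ h6 => h k c ζ ζ' N h1 h2 h3 h4 le_rfl h6⟩
  | succ l ih =>
    obtain ⟨r, C₀, e, hr, ih⟩ := ih
    refine ⟨r * d, 2 * C₀ + e, e, by positivity, fun k _ c ζ ζ' N hdk hN hζ hζ1 hζ' hζ'1 hl hKN => ?_⟩
    have T := (ih k c ζ ζ' N hdk hN hζ hζ1 hζ' hζ'1 (by omega) hKN).swap
    have hζ0' : ζ' ≠ 0 := by rintro rfl; rw [zero_pow (by omega)] at hζ'; exact zero_ne_one hζ'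
    obtain ⟨m, rfl⟩ : ∃ m, K = m + 1 + J := ⟨K - J - 1, by omega⟩
    have key : ∀ (S : Type u) [CommRing S] [Algebra k S] (x z : S),
        RelYZ d c ζ ζ' (m + 1 + J) J (m + 1 + J) l S x z (algebraMap k S c) →
        fit d c S J x = algebraMap k S (ζ'⁻¹ * fit d c k (l + 1) 0) ∧
        fit d c S (m + 1 + J) z = algebraMap k S (ζ * fit d c k (m + 1 + (l + 1)) 0) := by
      rintro S _ _ x z ⟨h1, h2⟩
      rw [fit_c S (by omega)] at h2
      have h3 : fit d c S J x = algebraMap k S (ζ'⁻¹ * fit d c k (l + 1) 0) := by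
        rw [map_mul, h2, ← mul_assoc, ← map_mul, inv_mul_cancel₀ hζ0']; simp
      refine ⟨h3, ?_⟩
      rw [h1, fit_add, h3, map_mul, fit_root (by rw [inv_pow, hζ', inv_one]) _ (by omega),
        ← algebraMap_fit, ← fit_add, map_mul]
    have T2 := T.step d hd hdk 1 c one_ne_zero ?_ ?_ ?_
    · refine T2.swap.congr ?_ ?_
      · intro B _ _ x y z
        simp only [RelYZ, map_one, one_mul]
        rfl
      · rintro x y z (rfl | ⟨s, hs, h⟩ | ⟨s, hs, h⟩)
        · exact Or.inr ⟨0, by omega, rfl⟩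
        · exact Or.inl ⟨s, hs, h⟩
        · refine Or.inr ⟨s + 1, by omega, ?_⟩
          rw [one_mul] at h
          exact h
    · intro S _ _ x z h
      obtain ⟨h1, h2⟩ := key S x z h
      refine ⟨der_zero_of_fit hdk _ _ _ _ h1 ?_, der_zero_of_fit hdk _ _ _ _ h2 ?_⟩
      · intro s hs1 hs2
        exact orb_ne hN (by omega) (by rw [inv_pow, hζ', inv_one]) (by simpa using hζ'1) (by omega)
          (by omega) (by omega)
      · intro s hs1 hs2
        exact orb_ne hN (by omega) hζ hζ1 (by omega) (by omega) (by omega)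
    · obtain ⟨x₀, hx₀⟩ := fit_surj (k := k) (d := d) (c := c) (L := AlgebraicClosure k) (by omega) J
        (algebraMap k _ (ζ'⁻¹ * fit d c k (l + 1) 0))
      obtain ⟨z₀, hz₀⟩ := fit_surj (k := k) (d := d) (c := c) (L := AlgebraicClosure k) (by omega)
        (m + 1 + J) (algebraMap k _ ζ * fit d c _ (m + 1 + J) x₀)
      refine ⟨x₀, z₀, hz₀, ?_⟩
      rw [fit_c _ (by omega), hx₀, ← map_mul, mul_inv_cancel_left₀ hζ0']
    · refine ⟨_, htr_aux (c := c) (d := d) (by omega) J ζ' (fit d c k (l + 1) 0) hζ0', ?_⟩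
      intro S _ _ x z h
      obtain ⟨h1, -⟩ := key S x z h
      rw [map_sub, map_mul, map_fit, aeval_X, aeval_C, aeval_C, h1, ← map_mul,
        mul_inv_cancel_left₀ hζ0', sub_self]

end tower2

section counting

/-- number of points on a tower -/
lemma tower_count (r C₀ : ℕ) (hr : 0 < r) (ε : ℝ) (hε : 0 < ε) : ∃ B : ℕ,
    ∀ (k : Type u) [Field k] [Fintype k] (Rel : RelT k) (Bad : k → k → k → Prop) (e : ℕ)
      (_ : Tower k Rel Bad r C₀ e) (p : ℕ) [CharP k p] (_ : p.Prime) (_ : B ≤ p)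
      (S : Finset (Σ _ : k, k × k)) (_ : ∀ t ∈ S, Rel k t.1 t.2.1 t.2.2 ∧ ¬ Bad t.1 t.2.1 t.2.2),
      (S.card : ℝ) ≤ (1 + ε) * Fintype.card k + B := by
  classical
  obtain ⟨B, hB⟩ := weak_weil.{u} r C₀ hr ε hε
  refine ⟨B, ?_⟩
  intro k _ _ Rel Bad e hT p _ hp hBp S hS
  obtain ⟨A, i1, i2, i3, x, y, z, G, a1, a2, a3, a4, a5, a6, a7⟩ := hT
  rcases S.eq_empty_or_nonempty with rfl | ⟨t₀, ht₀⟩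
  · simp only [Finset.card_empty, Nat.cast_zero]; positivity
  have : Nonempty (A →ₐ[k] k) := ⟨(a4 k t₀.1 t₀.2.1 t₀.2.2 (hS t₀ ht₀).1).choose⟩
  choose! φ hφ1 hφ2 hφ3 using fun t (ht : t ∈ S) => a4 k t.1 t.2.1 t.2.2 (hS t ht).1
  have hinj : Set.InjOn φ (S : Set (Σ _ : k, k × k)) := by
    intro t ht s hs hts
    rcases t with ⟨t1, t2, t3⟩
    rcases s with ⟨s1, s2, s3⟩
    have e1 := hφ1 _ ht; have e2 := hφ2 _ ht; have e3 := hφ3 _ ht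
    have f1 := hφ1 _ hs; have f2 := hφ2 _ hs; have f3 := hφ3 _ hs
    rw [hts] at e1 e2 e3
    simp only at *
    obtain rfl := e1.symm.trans f1
    obtain rfl := e2.symm.trans f2
    obtain rfl := e3.symm.trans f3
    rfl
  rw [← Finset.card_image_of_injOn hinj]
  refine hB k A x G p hp hBp _ ?_
  intro P hP
  obtain ⟨t, ht, rfl⟩ := Finset.mem_image.1 hP
  refine a7 _ ?_
  rw [hφ1 t ht, hφ2 t ht, hφ3 t ht]
  exact (hS t ht).2

/-- fibres -/
def fib {k : Type u} [Field k] [Fintype k] [DecidableEq k] (d : ℕ) (c : k) (n : ℕ) (t : k) :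
    Finset k := Finset.univ.filter (fun y => fit d c k n y = t)

section
variable {k : Type u} [Field k] [Fintype k] [DecidableEq k] {d : ℕ} {c : k}

lemma mem_fib {n : ℕ} {t y : k} : y ∈ fib d c n t ↔ fit d c k n y = t := by simp [fib]

lemma fib_zero (t : k) : fib d c 0 t = {t} := by ext; simp [mem_fib, fit_zero]

lemma card_fib_le (hd : 0 < d) (n : ℕ) (t : k) : (fib d c n t).card ≤ d ^ n := by
  have h0 := htr_aux (c := c) hd n 1 t one_ne_zero
  have h1 : fib d c n t ⊆ (C 1 * fit d c k[X] n X - C t).roots.toFinset := by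
    intro y hy
    rw [mem_fib] at hy
    rw [Multiset.mem_toFinset, mem_roots h0, IsRoot.def, ← coe_aeval_eq_eval]
    have := map_fit (d := d) (c := c) (aeval y : k[X] →ₐ[k] k) n X
    rw [map_sub, map_mul, this]
    simp [hy]
  refine (Finset.card_le_card h1).trans ((Multiset.toFinset_card_le _).trans ((card_roots' _).trans ?_))
  rw [C_1, one_mul, natDegree_sub_C]
  exact natDegree_fit_le hd n

open Classical in
/-- bad points x -/
noncomputable def xbad (d : ℕ) (c : k) (K : ℕ) (ζ : k) : Finset k :=
  Finset.univ.filter (fun x => ∃ a, 1 ≤ a ∧ a ≤ K ∧ ζ * fit d c k K x = fit d c k a 0)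

lemma card_xbad_le (hd : 0 < d) (K : ℕ) (ζ : k) (hζ : ζ ≠ 0) :
    (xbad d c K ζ).card ≤ K * d ^ K := by
  have h : xbad d c K ζ ⊆ (Finset.Icc 1 K).biUnion (fun a => fib d c K (ζ⁻¹ * fit d c k a 0)) := by
    intro x hx
    simp only [xbad, Finset.mem_filter] at hx
    obtain ⟨-, a, h1, h2, h3⟩ := hx
    simp only [Finset.mem_biUnion, Finset.mem_Icc, mem_fib]
    exact ⟨a, ⟨h1, h2⟩, by rw [← h3, inv_mul_cancel_left₀ hζ]⟩
  refine (Finset.card_le_card h).trans (Finset.card_biUnion_le.trans ?_)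
  refine (Finset.sum_le_sum fun a _ => card_fib_le hd K _).trans ?_
  simp

end

lemma root_ne_zero {k : Type u} [Field k] {d : ℕ} (hd : 2 ≤ d) {ζ : k} (hζ : ζ ^ d = 1) :
    ζ ≠ 0 := by
  rintro rfl; rw [zero_pow (by omega)] at hζ; exact zero_ne_one hζ

/-- upper bound for second moments -/
lemma countA (d K J : ℕ) (hd : 2 ≤ d) (hJ : J < K) (ε : ℝ) (hε : 0 < ε) : ∃ B : ℕ,
    ∀ (k : Type u) [Field k] [Fintype k] [DecidableEq k] (c ζ ζ' : k) (N p : ℕ) [CharP k p],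
      p.Prime → B ≤ p → (d : k) ≠ 0 → OrbInj d c N → K ≤ N →
      ζ ^ d = 1 → ζ ≠ 1 → ζ' ^ d = 1 → ζ' ≠ 1 →
      ((∑ x : k, (fib d c K (ζ * fit d c k K x)).card * (fib d c J (ζ' * fit d c k J x)).card : ℕ) : ℝ)
        ≤ (1 + ε) * Fintype.card k + B := by
  classical
  obtain ⟨r, C₀, e, hr, hT⟩ := tower_z.{u} d K J J hd hJ
  obtain ⟨B, hB⟩ := tower_count.{u} r C₀ hr ε hε
  refine ⟨B + (K * d ^ K + J * d ^ J) * (d ^ K * d ^ J), ?_⟩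
  intro k _ _ _ c ζ ζ' N p _ hp hBp hdk hN hKN hζ hζ1 hζ' hζ'1
  have hd0 : 0 < d := by omega
  set bad := xbad d c K ζ ∪ xbad d c J ζ' with hbad
  have hbc : bad.card ≤ K * d ^ K + J * d ^ J :=
    (Finset.card_union_le _ _).trans (add_le_add (card_xbad_le hd0 K ζ (root_ne_zero hd hζ))
      (card_xbad_le hd0 J ζ' (root_ne_zero hd hζ')))
  have h1 := hB k _ _ e (hT k c ζ ζ' N hdk hN hζ hζ1 hζ' hζ'1 le_rfl hKN) p hp (by omega)
    (badᶜ.sigma fun x => fib d c K (ζ * fit d c k K x) ×ˢ fib d c J (ζ' * fit d c k J x)) ?_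
  · rw [Finset.card_sigma] at h1
    simp only [Finset.card_product] at h1
    have h2 : ∑ x ∈ bad, (fib d c K (ζ * fit d c k K x)).card * (fib d c J (ζ' * fit d c k J x)).card
        ≤ (K * d ^ K + J * d ^ J) * (d ^ K * d ^ J) := by
      refine (Finset.sum_le_card_nsmul _ _ (d ^ K * d ^ J) fun x _ =>
        Nat.mul_le_mul (card_fib_le hd0 _ _) (card_fib_le hd0 _ _)).trans ?_
      rw [smul_eq_mul]
      exact Nat.mul_le_mul_right _ hbc
    rw [← Finset.sum_add_sum_compl bad, Nat.cast_add, Nat.cast_add]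
    have h3 : ((∑ x ∈ bad, (fib d c K (ζ * fit d c k K x)).card * (fib d c J (ζ' * fit d c k J x)).card : ℕ) : ℝ)
      ≤ ((K * d ^ K + J * d ^ J) * (d ^ K * d ^ J) : ℕ) := by exact_mod_cast h2
    linarith
  · rintro ⟨x, y, z⟩ ht
    simp only [Finset.mem_sigma, Finset.mem_compl, Finset.mem_product, mem_fib] at ht
    obtain ⟨hx, hy, hz⟩ := ht
    refine ⟨⟨hy, hz⟩, ?_⟩
    rintro (⟨s, hs, h⟩ | ⟨s, hs, h⟩)
    · apply hx
      simp only at h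
      refine Finset.mem_union_left _ (Finset.mem_filter.2 ⟨Finset.mem_univ _, K - s, by omega, by omega, ?_⟩)
      rw [← hy]
      conv_lhs => rw [show K = (K - s) + s by omega]
      rw [fit_add, h]
    · apply hx
      simp only at h
      refine Finset.mem_union_right _ (Finset.mem_filter.2 ⟨Finset.mem_univ _, J - s, by omega, by omega, ?_⟩)
      rw [← hz]
      conv_lhs => rw [show J = (J - s) + s by omega]
      rw [fit_add, h]

/-- upper bound for twisted curves -/
lemma countT (d K i : ℕ) (hd : 2 ≤ d) (hi : i < K) (ε : ℝ) (hε : 0 < ε) : ∃ B : ℕ,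
    ∀ (k : Type u) [Field k] [Fintype k] [DecidableEq k] (c ζ : k) (N p : ℕ) [CharP k p],
      p.Prime → B ≤ p → (d : k) ≠ 0 → OrbInj d c N → K ≤ N →
      ζ ^ d = 1 → ζ ≠ 1 → ∀ b : k, b ≠ 0 → 
      ((∑ x ∈ (xbad d c K ζ)ᶜ, (Finset.univ.filter (fun w : k => fit d c k i (b * w ^ d + c) =
        ζ * fit d c k K x)).card : ℕ) : ℝ) ≤ (1 + ε) * Fintype.card k + B := by
  classical
  obtain ⟨r, C₀, e, hr, hT⟩ := tower_y.{u} d K 0 i hd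
  obtain ⟨B, hB⟩ := tower_count.{u} (r * d) (2 * C₀ + e) (by positivity) ε hε
  refine ⟨B, ?_⟩
  intro k _ _ _ c ζ N p _ hp hBp hdk hN hKN hζ hζ1 b hb
  have hd0 : 0 < d := by omega
  have h1 := hB k _ _ e (tower_ystep hd hdk hN hζ hζ1 hi hKN b hb
    (hT k c ζ 1 N hdk hN hζ hζ1 (by omega) hKN)) p hp (by omega)
    ((xbad d c K ζ)ᶜ.sigma fun x => (Finset.univ.filter (fun w : k => fit d c k i (b * w ^ d + c) =
        ζ * fit d c k K x)) ×ˢ {x}) ?_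
  · rw [Finset.card_sigma] at h1
    simpa only [Finset.card_product, Finset.card_singleton, mul_one] using h1
  · rintro ⟨x, w, z⟩ ht
    simp only [Finset.mem_sigma, Finset.mem_compl, Finset.mem_product, Finset.mem_filter,
      Finset.mem_univ, true_and, Finset.mem_singleton] at ht
    obtain ⟨hx, hy, rfl⟩ := ht
    refine ⟨⟨hy, by simp [fit_zero]⟩, ?_⟩
    rintro (h | ⟨s, hs, h⟩ | ⟨s, hs, h⟩)
    · apply hx
      simp only at h
      refine Finset.mem_filter.2 ⟨Finset.mem_univ _, i + 1, by omega, by omega, ?_⟩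
      rw [← hy, h, fit_succ]
      simp [zero_pow hd0.ne']
    · apply hx
      simp only at h
      refine Finset.mem_filter.2 ⟨Finset.mem_univ _, i - s, by omega, by omega, ?_⟩
      rw [← hy]
      conv_lhs => rw [show i = (i - s) + s by omega]
      rw [fit_add, h]
    · omega

/-- lower bound for first moments -/
lemma countB (d K i : ℕ) (hd : 2 ≤ d) (hi : i ≤ K) (ε : ℝ) (hε : 0 < ε) : ∃ B : ℕ,
    ∀ (k : Type u) [Field k] [Fintype k] [DecidableEq k] (c ζ : k) (N p : ℕ) [CharP k p],
      p.Prime → B ≤ p → (d : k) ≠ 0 → OrbInj d c N → K ≤ N →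
      ζ ^ d = 1 → ζ ≠ 1 → 
      (1 - ε) * Fintype.card k - B ≤
      ((∑ x ∈ (xbad d c K ζ)ᶜ, (fib d c i (ζ * fit d c k K x)).card : ℕ) : ℝ) := by
  classical
  induction i generalizing ε with
  | zero =>
    refine ⟨K * d ^ K, ?_⟩
    intro k _ _ _ c ζ N p _ hp hBp hdk hN hKN hζ hζ1
    have h1 := card_xbad_le (c := c) (by omega : 0 < d) K ζ (root_ne_zero hd hζ)
    simp only [fib_zero, Finset.card_singleton, Finset.sum_const, smul_eq_mul, mul_one]
    rw [Finset.card_compl, Nat.cast_sub (Finset.card_le_univ _)]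
    have h2 : ((xbad d c K ζ).card : ℝ) ≤ ((K * d ^ K : ℕ) : ℝ) := by exact_mod_cast h1
    have h3 : (0 : ℝ) ≤ ε * Fintype.card k := by positivity
    linarith
  | succ i ih =>
    have hdR : (2 : ℝ) ≤ d := by exact_mod_cast hd
    obtain ⟨B₁, h₁⟩ := ih (by omega) (ε / (2 * d)) (by positivity)
    obtain ⟨B₂, h₂⟩ := countT.{u} d K i hd (by omega) (ε / (2 * d)) (by positivity)
    refine ⟨d * (B₁ + B₂), ?_⟩
    intro k _ _ _ c ζ N p _ hp hBp hdk hN hKN hζ hζ1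
    have hB1 : B₁ ≤ p := le_trans (by nlinarith) hBp
    have hB2 : B₂ ≤ p := le_trans (by nlinarith) hBp
    have H1 := h₁ k c ζ N p hp hB1 hdk hN hKN hζ hζ1
    have H2 := h₂ k c ζ N p hp hB2 hdk hN hKN hζ hζ1
    set q : ℝ := (Fintype.card k : ℝ) with hq
    set X := (xbad d c K ζ)ᶜ with hX
    set Y : ℝ := ((∑ x ∈ X, (fib d c i (ζ * fit d c k K x)).card : ℕ) : ℝ) with hY
    set Q : k → ℕ := fun b => ∑ x ∈ X, (Finset.univ.filter (fun w : k => fit d c k i (b * w ^ d + c) =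
        ζ * fit d c k K x)).card with hQ
    set U : ℝ := (1 + ε / (2 * d)) * q + B₂ with hU
    have hQU : ∀ b, b ≠ 0 → (Q b : ℝ) ≤ U := fun b hb => H2 b hb
    -- the next level
    have hQ1 : (∑ x ∈ X, (fib d c (i + 1) (ζ * fit d c k K x)).card) = Q 1 := by
      refine Finset.sum_congr rfl fun x _ => ?_
      congr 1
      ext w
      simp [mem_fib, fit_succ]
    have hQpow : ∀ a : k, a ≠ 0 → Q (a ^ d) = Q 1 := by
      intro a ha
      refine Finset.sum_congr rfl fun x _ => ?_
      refine Finset.card_bij (fun w _ => a * w) ?_ ?_ ?_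
      · intro w hw
        simp only [Finset.mem_filter, Finset.mem_univ, true_and] at hw ⊢
        rw [one_mul, mul_pow]; exact hw
      · intro w _ w' _ h
        exact mul_left_cancel₀ ha h
      · intro w hw
        simp only [Finset.mem_filter, Finset.mem_univ, true_and] at hw
        refine ⟨a⁻¹ * w, ?_, by rw [mul_inv_cancel_left₀ ha]⟩
        simp only [Finset.mem_filter, Finset.mem_univ, true_and]
        rw [← mul_pow, mul_inv_cancel_left₀ ha, ← hw, one_mul]
    set Z : Finset k := Finset.univ.erase 0 with hZ
    have hZc : (Z.card : ℝ) = q - 1 := by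
      rw [hZ, Finset.card_erase_of_mem (Finset.mem_univ _), Finset.card_univ,
        Nat.cast_sub Fintype.card_pos]; simp [hq]
    have hqpos : 0 < q - 1 := by
      rw [← hZc]
      exact_mod_cast Finset.card_pos.2 ⟨1, by simp [hZ]⟩
    have hsum : (q - 1) * Y ≤ ∑ b ∈ Z, (Q b : ℝ) := by
      have : Z.card * (∑ x ∈ X, (fib d c i (ζ * fit d c k K x)).card) ≤ ∑ b ∈ Z, Q b := by
        simp only [hQ]
        rw [Finset.sum_comm, Finset.mul_sum]
        refine Finset.sum_le_sum fun x hx => ?_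
        simp only [Finset.card_filter]
        rw [Finset.sum_comm]
        have hle : ∑ w ∈ Z, ∑ b ∈ Z, (if fit d c k i (b * w ^ d + c) = ζ * fit d c k K x then 1 else 0)
            ≤ ∑ w : k, ∑ b ∈ Z, (if fit d c k i (b * w ^ d + c) = ζ * fit d c k K x then 1 else 0) :=
          Finset.sum_le_sum_of_subset (Finset.subset_univ _)
        refine le_trans ?_ hle
        rw [← smul_eq_mul]
        refine Finset.card_nsmul_le_sum _ _ _ fun w hw => ?_
        have hw0 : w ≠ 0 := (Finset.mem_erase.1 hw).1
        rw [← Finset.card_filter]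
        refine Finset.card_le_card_of_injOn (fun y => (y - c) / w ^ d) ?_ ?_
        · intro y hy
          rw [Finset.mem_coe, mem_fib] at hy
          simp only [Finset.coe_filter, Set.mem_ofPred_eq]
          rw [div_mul_cancel₀ _ (pow_ne_zero _ hw0), sub_add_cancel]
          refine ⟨Finset.mem_erase.2 ⟨?_, Finset.mem_univ _⟩, hy⟩
          refine div_ne_zero ?_ (pow_ne_zero _ hw0)
          intro h0
          rw [sub_eq_zero] at h0
          subst h0
          rw [hX, Finset.mem_compl] at hx
          apply hx
          refine Finset.mem_filter.2 ⟨Finset.mem_univ _, i + 1, by omega, by omega, ?_⟩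
          rw [← hy, fit_succ]
          simp [zero_pow (by omega : d ≠ 0)]
        · intro y _ y' _ h
          simp only at h
          rw [div_left_inj' (pow_ne_zero _ hw0)] at h
          exact sub_left_injective h
      have h' : ((Z.card * (∑ x ∈ X, (fib d c i (ζ * fit d c k K x)).card) : ℕ) : ℝ) ≤
        ((∑ b ∈ Z, Q b : ℕ) : ℝ) := by exact_mod_cast this
      rw [Nat.cast_mul, hZc, Nat.cast_sum (s := Z)] at h'
      exact h'
    set Pw : Finset k := Z.image (fun a => a ^ d) with hPw
    have hPZ : Pw ⊆ Z := by
      intro b hb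
      obtain ⟨a, ha, rfl⟩ := Finset.mem_image.1 hb
      exact Finset.mem_erase.2 ⟨pow_ne_zero _ (Finset.mem_erase.1 ha).1, Finset.mem_univ _⟩
    have hPc : q - 1 ≤ d * (Pw.card : ℝ) := by
      have : Z.card ≤ d * Pw.card := by
        refine Finset.card_le_mul_card_image Z d fun b hb => ?_
        have : (Z.filter (fun a => a ^ d = b)) ⊆ (nthRoots d b).toFinset := by
          intro a ha
          rw [Multiset.mem_toFinset, mem_nthRoots (by omega)]
          exact (Finset.mem_filter.1 ha).2
        exact (Finset.card_le_card this).trans ((Multiset.toFinset_card_le _).trans (card_nthRoots _ _))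
      rw [← hZc]; exact_mod_cast this
    have hsplit : ∑ b ∈ Z, (Q b : ℝ) ≤ Pw.card * (Q 1 : ℝ) + (q - 1 - Pw.card) * U := by
      rw [← Finset.sum_sdiff hPZ, add_comm]
      refine add_le_add ?_ ?_
      · rw [← nsmul_eq_mul]
        refine Finset.sum_le_card_nsmul _ _ _ fun b hb => ?_
        obtain ⟨a, ha, rfl⟩ := Finset.mem_image.1 hb
        rw [hQpow a (Finset.mem_erase.1 ha).1]
      · have : ((Z \ Pw).card : ℝ) = q - 1 - Pw.card := by
          rw [Finset.card_sdiff_of_subset hPZ, Nat.cast_sub (Finset.card_le_card hPZ), hZc]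
        rw [← this, ← nsmul_eq_mul]
        refine Finset.sum_le_card_nsmul _ _ _ fun b hb => hQU b ?_
        exact (Finset.mem_erase.1 (Finset.mem_sdiff.1 hb).1).1
    rw [hQ1]
    have hPpos : 0 < (Pw.card : ℝ) := by
      by_contra h
      push Not at h
      nlinarith
    have hmain : (Pw.card : ℝ) * (U - Q 1) ≤ (q - 1) * (U - Y) := by nlinarith
    have hq0 : 0 ≤ q := by positivity
    have hgoal : (1 - ε) * q - d * (B₁ + B₂) ≤ d * Y - (d - 1) * U := by
      have hdd : ε / (2 * d) * d = ε / 2 := by field_simp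
      have e1 : (d : ℝ) * Y ≥ d * q - (ε / 2) * q - d * B₁ := by
        have := mul_le_mul_of_nonneg_left H1 (by positivity : (0 : ℝ) ≤ d)
        have h3 : (d : ℝ) * ((1 - ε / (2 * d)) * q - B₁) = d * q - (ε / (2 * d) * d) * q - d * B₁ := by ring
        rw [h3, hdd] at this
        linarith
      have e2 : ((d : ℝ) - 1) * U ≤ (d - 1) * q + (ε / 2) * q + d * B₂ := by
        have h3 : ((d : ℝ) - 1) * U = (d - 1) * q + (ε / (2 * d) * d) * q - (ε / (2 * d)) * q + d * B₂ - B₂ := by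
          rw [hU]; ring
        rw [h3, hdd]
        have : 0 ≤ (ε / (2 * d)) * q := by positivity
        have : (0 : ℝ) ≤ B₂ := by positivity
        linarith
      linarith
    push_cast
    by_cases hYU : Y ≤ U
    · refine hgoal.trans ?_
      have h5 : (Pw.card : ℝ) * (U - Q 1) ≤ Pw.card * (d * (U - Y)) := by
        refine hmain.trans ?_
        have := mul_le_mul_of_nonneg_right hPc (sub_nonneg.2 hYU)
        linarith
      have h6 := le_of_mul_le_mul_left h5 hPpos
      linarith
    · push Not at hYU
      have h5 : (Pw.card : ℝ) * (U - Q 1) ≤ 0 := hmain.trans (by nlinarith)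
      have h6 : U ≤ Q 1 := by
        by_contra h7
        push Not at h7
        nlinarith
      refine le_trans ?_ h6
      rw [hU]
      have : 0 ≤ (ε / (2 * d)) * q := by positivity
      have : (0 : ℝ) ≤ B₂ := by positivity
      have : (0 : ℝ) ≤ d * (B₁ + B₂) := by positivity
      have : 0 ≤ ε * q := by positivity
      linarith

end counting

section moments

/-- the random variable -/
def Vc {k : Type u} [Field k] [Fintype k] [DecidableEq k] (d : ℕ) (c : k) (K : ℕ) (ζ x : k) : ℝ :=
  ((fib d c K (ζ * fit d c k K x)).card : ℝ)

lemma Vc_nonneg {k : Type u} [Field k] [Fintype k] [DecidableEq k] (d : ℕ) (c : k) (K : ℕ)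
    (ζ x : k) : 0 ≤ Vc d c K ζ x := Nat.cast_nonneg _

lemma fib_self_subset {k : Type u} [Field k] [Fintype k] [DecidableEq k] (d : ℕ) (hd : 0 < d)
    (c : k) (K : ℕ) (y : k) :
    fib d c K (fit d c k K y) ⊆ {y} ∪ (Finset.range K).biUnion (fun j =>
      (Finset.univ.filter (fun ζ : k => ζ ^ d = 1 ∧ ζ ≠ 1)).biUnion
        (fun ζ => fib d c j (ζ * fit d c k j y))) := by
  induction K with
  | zero => simp [fib_zero, fit_zero]
  | succ K ih =>
    intro z hz
    rw [mem_fib] at hz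
    by_cases h : fit d c k K z = fit d c k K y
    · have h1 := ih (mem_fib.2 h)
      rcases Finset.mem_union.1 h1 with h1 | h1
      · exact Finset.mem_union_left _ h1
      · refine Finset.mem_union_right _ ?_
        exact Finset.biUnion_subset_biUnion_of_subset_left _
          (Finset.range_mono (Nat.le_succ K)) h1
    · refine Finset.mem_union_right _ ?_
      rw [fit_succ', fit_succ', add_left_inj] at hz
      have hy : fit d c k K y ≠ 0 := by
        intro h0
        rw [h0, zero_pow hd.ne'] at hz
        rw [h0] at h
        exact h (pow_eq_zero_iff hd.ne' |>.1 hz)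
      simp only [Finset.mem_biUnion, Finset.mem_filter, Finset.mem_univ, true_and, Finset.mem_range]
      refine ⟨K, by omega, fit d c k K z / fit d c k K y, ⟨?_, ?_⟩, ?_⟩
      · rw [div_pow, hz, div_self (pow_ne_zero _ hy)]
      · intro h1
        rw [div_eq_one_iff_eq hy] at h1
        exact h h1
      · rw [mem_fib, div_mul_cancel₀ _ hy]

lemma card_roots_le {k : Type u} [Field k] [Fintype k] [DecidableEq k] (d : ℕ) (hd : 0 < d) :
    (Finset.univ.filter (fun ζ : k => ζ ^ d = 1 ∧ ζ ≠ 1)).card ≤ d := by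
  have : (Finset.univ.filter (fun ζ : k => ζ ^ d = 1 ∧ ζ ≠ 1)) ⊆ (nthRoots d (1 : k)).toFinset := by
    intro a ha
    rw [Multiset.mem_toFinset, mem_nthRoots hd]
    exact (Finset.mem_filter.1 ha).2.1
  exact (Finset.card_le_card this).trans ((Multiset.toFinset_card_le _).trans (card_nthRoots _ _))

/-- uniform version of countA -/
lemma countA' (d m : ℕ) (hd : 2 ≤ d) (ε : ℝ) (hε : 0 < ε) : ∃ B : ℕ,
    ∀ (k : Type u) [Field k] [Fintype k] [DecidableEq k] (c : k) (p : ℕ) [CharP k p],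
      p.Prime → B ≤ p → (d : k) ≠ 0 → OrbInj d c m → ∀ K J, J < K → K ≤ m → ∀ ζ ζ' : k,
      ζ ^ d = 1 → ζ ≠ 1 → ζ' ^ d = 1 → ζ' ≠ 1 →
      ∑ x : k, Vc d c K ζ x * Vc d c J ζ' x ≤ (1 + ε) * Fintype.card k + B := by
  have h : ∀ K J : ℕ, ∃ B : ℕ, J < K →
    ∀ (k : Type u) [Field k] [Fintype k] [DecidableEq k] (c ζ ζ' : k) (N p : ℕ) [CharP k p],
      p.Prime → B ≤ p → (d : k) ≠ 0 → OrbInj d c N → K ≤ N →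
      ζ ^ d = 1 → ζ ≠ 1 → ζ' ^ d = 1 → ζ' ≠ 1 →
      ((∑ x : k, (fib d c K (ζ * fit d c k K x)).card * (fib d c J (ζ' * fit d c k J x)).card : ℕ) : ℝ)
        ≤ (1 + ε) * Fintype.card k + B := by
    intro K J
    by_cases hJ : J < K
    · obtain ⟨B, hB⟩ := countA.{u} d K J hd hJ ε hε
      exact ⟨B, fun _ => hB⟩
    · exact ⟨0, fun h => absurd h hJ⟩
  choose B hB using h
  refine ⟨∑ K ∈ Finset.range (m + 1), ∑ J ∈ Finset.range (m + 1), B K J, ?_⟩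
  intro k _ _ _ c p _ hp hBp hdk hN K J hJ hK ζ ζ' h1 h2 h3 h4
  have hle : B K J ≤ ∑ K ∈ Finset.range (m + 1), ∑ J ∈ Finset.range (m + 1), B K J := by
    refine le_trans ?_ (Finset.single_le_sum (f := fun K => ∑ J ∈ Finset.range (m + 1), B K J)
      (fun _ _ => Nat.zero_le _) (Finset.mem_range.2 (by omega : K < m + 1)))
    exact Finset.single_le_sum (f := fun J => B K J)
      (fun _ _ => Nat.zero_le _) (Finset.mem_range.2 (by omega : J < m + 1))
  have := hB K J hJ k c ζ ζ' m p hp (hle.trans hBp) hdk hN hK h1 h2 h3 h4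
  have hle' : (B K J : ℝ) ≤ ((∑ K ∈ Finset.range (m + 1), ∑ J ∈ Finset.range (m + 1), B K J : ℕ) : ℝ) := by
    exact_mod_cast hle
  rw [Nat.cast_sum] at this
  simp only [Nat.cast_mul] at this
  simp only [Vc]
  linarith

lemma countB' (d m : ℕ) (hd : 2 ≤ d) (ε : ℝ) (hε : 0 < ε) : ∃ B : ℕ,
    ∀ (k : Type u) [Field k] [Fintype k] [DecidableEq k] (c : k) (p : ℕ) [CharP k p],
      p.Prime → B ≤ p → (d : k) ≠ 0 → OrbInj d c m → ∀ K, K ≤ m → ∀ ζ : k,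
      ζ ^ d = 1 → ζ ≠ 1 →
      (1 - ε) * Fintype.card k - B ≤ ∑ x : k, Vc d c K ζ x := by
  choose B hB using fun K => countB.{u} d K K hd le_rfl ε hε
  refine ⟨∑ K ∈ Finset.range (m + 1), B K, ?_⟩
  intro k _ _ _ c p _ hp hBp hdk hN K hK ζ h1 h2
  have hle : B K ≤ ∑ K ∈ Finset.range (m + 1), B K :=
    Finset.single_le_sum (f := fun J => B J)
      (fun _ _ => Nat.zero_le _) (Finset.mem_range.2 (by omega : K < m + 1))
  have := hB K k c ζ m p hp (hle.trans hBp) hdk hN hK h1 h2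
  have hle' : (B K : ℝ) ≤ ((∑ K ∈ Finset.range (m + 1), B K : ℕ) : ℝ) := by
    exact_mod_cast hle
  have h3 : ((∑ x ∈ (xbad d c K ζ)ᶜ, (fib d c K (ζ * fit d c k K x)).card : ℕ) : ℝ) ≤
      ∑ x : k, Vc d c K ζ x := by
    rw [Nat.cast_sum]
    exact Finset.sum_le_sum_of_subset_of_nonneg (Finset.subset_univ _)
      (fun x _ _ => Vc_nonneg d c K ζ x)
  linarith

lemma sum_sq_le {k : Type u} [Field k] [Fintype k] [DecidableEq k] (d : ℕ) (hd : 2 ≤ d) (c : k)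
    (K : ℕ) (hK : 0 < K) (ζ : k) (hζ : ζ ^ d = 1) (hζ1 : ζ ≠ 1) (M : ℝ) (hM0 : 0 ≤ M)
    (hM : ∀ J < K, ∀ ζ ζ' : k, ζ ^ d = 1 → ζ ≠ 1 → ζ' ^ d = 1 → ζ' ≠ 1 →
      ∑ x : k, Vc d c K ζ x * Vc d c J ζ' x ≤ M) :
    ∑ x : k, Vc d c K ζ x * Vc d c K ζ x ≤ (1 + K * d) * M := by
  have hζ0 := root_ne_zero hd hζ
  set R := (Finset.univ.filter (fun ζ : k => ζ ^ d = 1 ∧ ζ ≠ 1)) with hR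
  have h1 : ∑ x : k, Vc d c K ζ x * Vc d c K ζ x =
      ∑ y : k, Vc d c K ζ⁻¹ y * ((fib d c K (fit d c k K y)).card : ℝ) := by
    have e1 : ∀ x : k, Vc d c K ζ x * Vc d c K ζ x = ∑ y : k,
        if fit d c k K y = ζ * fit d c k K x then ((fib d c K (fit d c k K y)).card : ℝ) else 0 := by
      intro x
      rw [← Finset.sum_filter]
      rw [Finset.sum_congr rfl (g := fun _ => Vc d c K ζ x)]
      · rw [Finset.sum_const, nsmul_eq_mul]; rfl
      · intro y hy
        rw [(Finset.mem_filter.1 hy).2]; rfl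
    rw [Finset.sum_congr rfl fun x _ => e1 x, Finset.sum_comm]
    refine Finset.sum_congr rfl fun y _ => ?_
    rw [← Finset.sum_filter, Finset.sum_const, nsmul_eq_mul]
    congr 2
    congr 1
    ext x
    simp only [Finset.mem_filter, Finset.mem_univ, true_and, mem_fib]
    rw [eq_inv_mul_iff_mul_eq₀ hζ0, eq_comm]
  have h2 : ∀ y : k, ((fib d c K (fit d c k K y)).card : ℝ) ≤
      1 + ∑ j ∈ Finset.range K, ∑ ζ' ∈ R, Vc d c j ζ' y := by
    intro y
    have := Finset.card_le_card (fib_self_subset d (by omega) c K y)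
    have h3 := this.trans (Finset.card_union_le _ _)
    have h4 := h3.trans (add_le_add le_rfl Finset.card_biUnion_le)
    have h5 := h4.trans (add_le_add le_rfl (Finset.sum_le_sum fun j _ => Finset.card_biUnion_le))
    rw [Finset.card_singleton] at h5
    have h6 : ((fib d c K (fit d c k K y)).card : ℝ) ≤ ((1 + ∑ j ∈ Finset.range K, ∑ ζ' ∈ R,
      (fib d c j (ζ' * fit d c k j y)).card : ℕ) : ℝ) := by exact_mod_cast h5
    push_cast at h6
    exact h6
  have hi : ζ⁻¹ ^ d = 1 := by rw [inv_pow, hζ, inv_one]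
  have hi1 : ζ⁻¹ ≠ 1 := by simpa using hζ1
  rw [h1]
  calc ∑ y : k, Vc d c K ζ⁻¹ y * ((fib d c K (fit d c k K y)).card : ℝ)
      ≤ ∑ y : k, Vc d c K ζ⁻¹ y * (1 + ∑ j ∈ Finset.range K, ∑ ζ' ∈ R, Vc d c j ζ' y) :=
        Finset.sum_le_sum fun y _ => mul_le_mul_of_nonneg_left (h2 y) (Vc_nonneg _ _ _ _ _)
    _ = ∑ y : k, Vc d c K ζ⁻¹ y * Vc d c 0 ζ y +
        ∑ j ∈ Finset.range K, ∑ ζ' ∈ R, ∑ y : k, Vc d c K ζ⁻¹ y * Vc d c j ζ' y := by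
        simp only [mul_add, Finset.sum_add_distrib, Finset.mul_sum]
        congr 1
        · simp [Vc, fib_zero]
        · rw [Finset.sum_comm]
          refine Finset.sum_congr rfl fun j _ => ?_
          rw [Finset.sum_comm]
    _ ≤ M + ∑ j ∈ Finset.range K, ∑ ζ' ∈ R, M := by
        refine add_le_add (hM 0 hK _ _ hi hi1 hζ hζ1) ?_
        refine Finset.sum_le_sum fun j hj => Finset.sum_le_sum fun ζ' hζ' => ?_
        have := (Finset.mem_filter.1 hζ').2
        exact hM j (Finset.mem_range.1 hj) _ _ hi hi1 this.1 this.2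
    _ ≤ (1 + K * d) * M := by
        simp only [Finset.sum_const, nsmul_eq_mul, Finset.card_range]
        have : (R.card : ℝ) ≤ d := by exact_mod_cast card_roots_le (k := k) d (by omega)
        have h7 : (K : ℝ) * ((R.card : ℝ) * M) ≤ K * (d * M) := by gcongr
        linarith

/-- abstract second moment bound -/
lemma second_moment {k : Type u} [Fintype k] (m : ℕ) (V : ℕ → k → ℝ) (q ε B D : ℝ)
    (hq : q = Fintype.card k) 
    (h1 : ∀ K ∈ Finset.Icc 1 m, (1 - ε) * q - B ≤ ∑ x, V K x)
    (h2 : ∀ K ∈ Finset.Icc 1 m, ∀ J ∈ Finset.Icc 1 m, ∑ x, V K x * V J x ≤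
      (1 + ε) * q + B + if K = J then D * K * (q + B) else 0)
    (μ : ℝ) (hμ : μ = ∑ K ∈ Finset.Icc 1 m, (1 / K : ℝ)) :
    ∑ x, ((∑ K ∈ Finset.Icc 1 m, V K x / K) - μ) ^ 2 ≤
      3 * ε * μ ^ 2 * q + D * μ * (q + B) + 3 * μ ^ 2 * B := by
  have hμ0 : 0 ≤ μ := by rw [hμ]; positivity
  have e1 : ∑ x, (∑ K ∈ Finset.Icc 1 m, V K x / K) =
      ∑ K ∈ Finset.Icc 1 m, (1 / K : ℝ) * ∑ x, V K x := by
    rw [Finset.sum_comm]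
    refine Finset.sum_congr rfl fun K _ => ?_
    rw [Finset.mul_sum]
    refine Finset.sum_congr rfl fun x _ => by ring
  have e2 : μ * ((1 - ε) * q - B) ≤ ∑ x, (∑ K ∈ Finset.Icc 1 m, V K x / K) := by
    rw [e1, hμ, Finset.sum_mul]
    refine Finset.sum_le_sum fun K hK => mul_le_mul_of_nonneg_left (h1 K hK) (by positivity)
  have e3 : ∑ x, (∑ K ∈ Finset.Icc 1 m, V K x / K) ^ 2 =
      ∑ K ∈ Finset.Icc 1 m, ∑ J ∈ Finset.Icc 1 m, (1 / K : ℝ) * (1 / J : ℝ) * ∑ x, V K x * V J x := by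
    simp only [sq, Finset.sum_mul_sum]
    rw [Finset.sum_comm]
    refine Finset.sum_congr rfl fun K _ => ?_
    rw [Finset.sum_comm]
    refine Finset.sum_congr rfl fun J _ => ?_
    rw [Finset.mul_sum]
    refine Finset.sum_congr rfl fun x _ => by ring
  have e4 : ∑ x, (∑ K ∈ Finset.Icc 1 m, V K x / K) ^ 2 ≤
      μ ^ 2 * ((1 + ε) * q + B) + D * μ * (q + B) := by
    rw [e3]
    calc _ ≤ ∑ K ∈ Finset.Icc 1 m, ∑ J ∈ Finset.Icc 1 m, (1 / K : ℝ) * (1 / J : ℝ) *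
          ((1 + ε) * q + B + if K = J then D * K * (q + B) else 0) :=
          Finset.sum_le_sum fun K hK => Finset.sum_le_sum fun J hJ =>
            mul_le_mul_of_nonneg_left (h2 K hK J hJ) (by positivity)
      _ = _ := by
          have t1 : ∑ K ∈ Finset.Icc 1 m, ∑ J ∈ Finset.Icc 1 m, (1 / K : ℝ) * (1 / J : ℝ) *
            ((1 + ε) * q + B) = μ ^ 2 * ((1 + ε) * q + B) := by
            rw [sq, hμ, Finset.sum_mul_sum, Finset.sum_mul]
            refine Finset.sum_congr rfl fun K _ => ?_
            rw [Finset.sum_mul]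
          have t2 : ∑ K ∈ Finset.Icc 1 m, ∑ J ∈ Finset.Icc 1 m, (1 / K : ℝ) * (1 / J : ℝ) *
            (if K = J then D * K * (q + B) else 0) = D * μ * (q + B) := by
            rw [hμ, mul_assoc, Finset.sum_mul, Finset.mul_sum]
            refine Finset.sum_congr rfl fun K hK => ?_
            have hK0 : (K : ℝ) ≠ 0 := by
              have := (Finset.mem_Icc.1 hK).1
              positivity
            simp only [mul_ite, mul_zero]
            rw [Finset.sum_ite_eq, if_pos hK]
            field_simp
          rw [← t1, ← t2, ← Finset.sum_add_distrib]
          refine Finset.sum_congr rfl fun K _ => ?_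
          rw [← Finset.sum_add_distrib]
          refine Finset.sum_congr rfl fun J _ => ?_
          ring
  have e5 : ∑ x, ((∑ K ∈ Finset.Icc 1 m, V K x / K) - μ) ^ 2 =
      ∑ x, (∑ K ∈ Finset.Icc 1 m, V K x / K) ^ 2 - 2 * μ * ∑ x, (∑ K ∈ Finset.Icc 1 m, V K x / K)
        + q * μ ^ 2 := by
    simp only [sub_sq, Finset.sum_add_distrib, Finset.sum_sub_distrib, Finset.sum_const,
      nsmul_eq_mul, Finset.card_univ, hq]
    congr 2
    rw [Finset.mul_sum]
    refine Finset.sum_congr rfl fun x _ => by ring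
  rw [e5]
  nlinarith [mul_le_mul_of_nonneg_left e2 hμ0]

end moments

section image

lemma fit_eq_of_le {k : Type u} [Field k] {d : ℕ} {c : k} {K L : ℕ} (h : K ≤ L) {x y : k}
    (hxy : fit d c k K x = fit d c k K y) : fit d c k L x = fit d c k L y := by
  obtain ⟨n, rfl⟩ := Nat.exists_eq_add_of_le h
  rw [Nat.add_comm, fit_add, fit_add, hxy]

lemma fit_eq_of_lt {k : Type u} [Field k] {d : ℕ} {c ζ : k} (hζ : ζ ^ d = 1) {K L : ℕ} (h : K < L)
    {x y : k} (hxy : fit d c k K y = ζ * fit d c k K x) : fit d c k L y = fit d c k L x := by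
  refine fit_eq_of_le (Nat.succ_le_of_lt h) ?_
  rw [Nat.succ_eq_add_one, fit_succ', fit_succ', hxy, mul_pow, hζ, one_mul]

lemma sum_Vc_le {k : Type u} [Field k] [Fintype k] [DecidableEq k] (d : ℕ) (c : k) (m : ℕ)
    (ζ : k) (hζ : ζ ^ d = 1) (hζ1 : ζ ≠ 1) (x : k) (hx : ∀ K ∈ Finset.Icc 1 m, fit d c k K x ≠ 0) :
    ∑ K ∈ Finset.Icc 1 m, Vc d c K ζ x / K ≤ ((fib d c (m + 1) (fit d c k (m + 1) x)).card : ℝ) := by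
  have key : ∀ K ∈ Finset.Icc 1 m, ∀ J ∈ Finset.Icc 1 m, K < J →
      Disjoint (fib d c K (ζ * fit d c k K x)) (fib d c J (ζ * fit d c k J x)) := by
    intro K _ J hJ hKJ
    rw [Finset.disjoint_left]
    intro y hy hy'
    rw [mem_fib] at hy hy'
    rw [fit_eq_of_lt hζ hKJ hy] at hy'
    refine hζ1 (mul_right_cancel₀ (hx J hJ) ?_)
    rw [one_mul, ← hy']
  have h1 : ((Finset.Icc 1 m).biUnion fun K => fib d c K (ζ * fit d c k K x)).card =
      ∑ K ∈ Finset.Icc 1 m, (fib d c K (ζ * fit d c k K x)).card := by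
    refine Finset.card_biUnion ?_
    intro K hK J hJ hne
    rcases lt_or_gt_of_ne hne with h | h
    · exact key K hK J hJ h
    · exact (key J hJ K hK h).symm
  have h2 : ((Finset.Icc 1 m).biUnion fun K => fib d c K (ζ * fit d c k K x)) ⊆
      fib d c (m + 1) (fit d c k (m + 1) x) := by
    intro y hy
    obtain ⟨K, hK, hy⟩ := Finset.mem_biUnion.1 hy
    rw [mem_fib] at hy ⊢
    exact fit_eq_of_lt hζ (Nat.lt_succ_of_le (Finset.mem_Icc.1 hK).2) hy
  have h3 := Finset.card_le_card h2
  rw [h1] at h3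
  calc ∑ K ∈ Finset.Icc 1 m, Vc d c K ζ x / K ≤ ∑ K ∈ Finset.Icc 1 m, Vc d c K ζ x :=
        Finset.sum_le_sum fun K hK => div_le_self (Vc_nonneg _ _ _ _ _)
          (by exact_mod_cast (Finset.mem_Icc.1 hK).1)
    _ ≤ _ := by
        have h4 : ((∑ K ∈ Finset.Icc 1 m, (fib d c K (ζ * fit d c k K x)).card : ℕ) : ℝ) ≤
          ((fib d c (m + 1) (fit d c k (m + 1) x)).card : ℝ) := by exact_mod_cast h3
        rw [Nat.cast_sum] at h4
        exact h4

lemma image_card_le {k : Type u} [Field k] [Fintype k] [DecidableEq k] (d : ℕ) (hd : 2 ≤ d) (c : k)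
    (m : ℕ) (ζ : k) (hζ : ζ ^ d = 1) (hζ1 : ζ ≠ 1) (μ : ℝ) (hμ : 0 < μ) :
    ((Finset.univ.image (fit d c k (m + 1))).card : ℝ) ≤ 2 * Fintype.card k / μ +
      4 / μ ^ 2 * ∑ x, ((∑ K ∈ Finset.Icc 1 m, Vc d c K ζ x / K) - μ) ^ 2 + m * d ^ m := by
  set W : k → ℝ := fun x => ∑ K ∈ Finset.Icc 1 m, Vc d c K ζ x / K with hW
  set B1 : Finset k := Finset.univ.filter fun x => W x < μ / 2 with hB1
  set B2 : Finset k := (Finset.Icc 1 m).biUnion fun K => fib d c K 0 with hB2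
  set G : Finset k := (B1 ∪ B2)ᶜ with hG
  have hc1 : (B1.card : ℝ) ≤ 4 / μ ^ 2 * ∑ x, (W x - μ) ^ 2 := by
    have h1 : ∑ x ∈ B1, (μ ^ 2 / 4) ≤ ∑ x, (W x - μ) ^ 2 := by
      refine (Finset.sum_le_sum fun x hx => ?_).trans
        (Finset.sum_le_sum_of_subset_of_nonneg (Finset.subset_univ B1) fun x _ _ => sq_nonneg _)
      have := (Finset.mem_filter.1 hx).2
      nlinarith
    rw [Finset.sum_const, nsmul_eq_mul] at h1
    rw [div_mul_eq_mul_div, le_div_iff₀ (by positivity)]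
    linarith
  have hc2 : (B2.card : ℝ) ≤ m * d ^ m := by
    have : B2.card ≤ m * d ^ m := by
      refine Finset.card_biUnion_le.trans ?_
      refine (Finset.sum_le_card_nsmul _ _ (d ^ m) fun K hK => ?_).trans ?_
      · exact (card_fib_le (by omega) K 0).trans
          (Nat.pow_le_pow_right (by omega) (Finset.mem_Icc.1 hK).2)
      · simp
    exact_mod_cast this
  have hc3 : ((G.image (fit d c k (m + 1))).card : ℝ) ≤ 2 * Fintype.card k / μ := by
    have h1 : ∑ t ∈ G.image (fit d c k (m + 1)), (fib d c (m + 1) t).card ≤ Fintype.card k := by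
      rw [← Finset.card_biUnion]
      · exact Finset.card_le_univ _
      · intro s _ t _ hst
        refine Finset.disjoint_left.2 fun y hy hy' => hst ?_
        rw [mem_fib] at hy hy'
        rw [← hy, hy']
    have h2 : ∑ t ∈ G.image (fit d c k (m + 1)), (μ / 2) ≤ Fintype.card k := by
      refine le_trans (Finset.sum_le_sum
        (g := fun t => ((fib d c (m + 1) t).card : ℝ)) fun t ht => ?_) (by exact_mod_cast h1)
      obtain ⟨x, hx, rfl⟩ := Finset.mem_image.1 ht
      simp only [hG, Finset.mem_compl, Finset.mem_union, not_or, hB1, hB2, Finset.mem_filter,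
        Finset.mem_univ, true_and, not_lt, Finset.mem_biUnion, not_exists, not_and, mem_fib] at hx
      exact hx.1.trans (sum_Vc_le d c m ζ hζ hζ1 x hx.2)
    rw [Finset.sum_const, nsmul_eq_mul] at h2
    rw [le_div_iff₀ hμ]
    linarith
  have h4 : (Finset.univ.image (fit d c k (m + 1))).card ≤
      (G.image (fit d c k (m + 1))).card + (B1.card + B2.card) := by
    have : Finset.univ.image (fit d c k (m + 1)) ⊆
        G.image (fit d c k (m + 1)) ∪ (B1 ∪ B2).image (fit d c k (m + 1)) := by
      rw [← Finset.image_union]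
      refine Finset.image_subset_image fun x _ => ?_
      simp only [hG, Finset.mem_union, Finset.mem_compl]
      tauto
    refine (Finset.card_le_card this).trans ((Finset.card_union_le _ _).trans ?_)
    exact Nat.add_le_add_left (Finset.card_image_le.trans (Finset.card_union_le _ _)) _
  have h5 : ((Finset.univ.image (fit d c k (m + 1))).card : ℝ) ≤
      (G.image (fit d c k (m + 1))).card + (B1.card + B2.card) := by exact_mod_cast h4
  linarith

lemma exists_harmonic (R : ℝ) : ∃ m : ℕ, R ≤ ∑ K ∈ Finset.Icc 1 m, (1 / K : ℝ) := by
  obtain ⟨m, hm⟩ := (Real.tendsto_sum_range_one_div_nat_succ_atTop.eventually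
    (Filter.eventually_ge_atTop R)).exists
  refine ⟨m, hm.trans_eq ?_⟩
  clear hm
  induction m with
  | zero => simp
  | succ n ih => rw [Finset.sum_range_succ, Finset.sum_Icc_succ_top (by omega), ih]; push_cast; rfl

lemma imageBound (d : ℕ) (hd : 2 ≤ d) (η : ℝ) (hη : 0 < η) : ∃ m B : ℕ,
    ∀ (k : Type u) [Field k] [Fintype k] [DecidableEq k] (c : k) (p : ℕ) [CharP k p],
      p.Prime → B ≤ p → (d : k) ≠ 0 → OrbInj d c m → (∃ ζ : k, ζ ^ d = 1 ∧ ζ ≠ 1) →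
      ((Finset.univ.image (fit d c k (m + 1))).card : ℝ) ≤ η * Fintype.card k + B := by
  obtain ⟨m, hm⟩ := exists_harmonic (max 1 (2 * (2 + 8 * d) / η))
  set μ := ∑ K ∈ Finset.Icc 1 m, (1 / K : ℝ) with hμ
  have hμ1 : 1 ≤ μ := (le_max_left _ _).trans hm
  have hμ2 : 2 * (2 + 8 * d) / η ≤ μ := (le_max_right _ _).trans hm
  have hμ0 : 0 < μ := by linarith
  set ε : ℝ := min 1 (η / 24) with hε
  have hε0 : 0 < ε := by positivity
  have hε1 : ε ≤ 1 := min_le_left _ _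
  have hε2 : ε ≤ η / 24 := min_le_right _ _
  obtain ⟨B₁, hB₁⟩ := countA'.{u} d m hd ε hε0
  obtain ⟨B₂, hB₂⟩ := countB'.{u} d m hd ε hε0
  refine ⟨m, 8 * d * (B₁ + B₂) + 12 * (B₁ + B₂) + m * d ^ m, ?_⟩
  intro k _ _ _ c p _ hp hBp hdk hN ⟨ζ, hζ, hζ1⟩
  have hp1 : B₁ ≤ p := by
    refine le_trans ?_ hBp; nlinarith [Nat.zero_le (8 * d * (B₁ + B₂)), Nat.zero_le (m * d ^ m)]
  have hp2 : B₂ ≤ p := by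
    refine le_trans ?_ hBp; nlinarith [Nat.zero_le (8 * d * (B₁ + B₂)), Nat.zero_le (m * d ^ m)]
  obtain ⟨q, hq⟩ : ∃ q : ℝ, q = (Fintype.card k : ℝ) := ⟨_, rfl⟩
  have hq0 : 0 ≤ q := by rw [hq]; exact Nat.cast_nonneg _
  set B : ℝ := (B₁ : ℝ) + B₂ with hB
  have hb1 : (0 : ℝ) ≤ B₁ := Nat.cast_nonneg _
  have hb2 : (0 : ℝ) ≤ B₂ := Nat.cast_nonneg _
  have hA : ∀ K J, J < K → K ≤ m → ∀ ζ ζ' : k, ζ ^ d = 1 → ζ ≠ 1 → ζ' ^ d = 1 → ζ' ≠ 1 →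
      ∑ x : k, Vc d c K ζ x * Vc d c J ζ' x ≤ (1 + ε) * q + B := by
    intro K J hJ hK ζ ζ' h1 h2 h3 h4
    have := hB₁ k c p hp hp1 hdk hN K J hJ hK ζ ζ' h1 h2 h3 h4
    rw [← hq] at this
    linarith
  have hM0 : 0 ≤ (1 + ε) * q + B := by positivity
  have sm := second_moment m (fun K x => Vc d c K ζ x) q ε B (2 * d) hq
    (fun K hK => by
      have := hB₂ k c p hp hp2 hdk hN K (Finset.mem_Icc.1 hK).2 ζ hζ hζ1
      rw [← hq] at this
      linarith)
    (fun K hK J hJ => by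
      rw [Finset.mem_Icc] at hK hJ
      rcases lt_trichotomy K J with h | h | h
      · rw [if_neg h.ne, add_zero]
        simp only [mul_comm (Vc d c K ζ _)]
        exact hA J K h hJ.2 ζ ζ hζ hζ1 hζ hζ1
      · subst h
        rw [if_pos rfl]
        have := sum_sq_le d hd c K (by omega) ζ hζ hζ1 _ hM0
          (fun J hJ ζ ζ' h1 h2 h3 h4 => hA K J hJ hK.2 ζ ζ' h1 h2 h3 h4)
        have h5 : (1 + ε) * q + B ≤ 2 * (q + B) := by nlinarith
        have h6 : (K * d : ℝ) * ((1 + ε) * q + B) ≤ (K * d : ℝ) * (2 * (q + B)) :=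
          mul_le_mul_of_nonneg_left h5 (by positivity)
        linarith
      · rw [if_neg h.ne', add_zero]
        exact hA K J h hK.2 ζ ζ hζ hζ1 hζ hζ1)
    μ hμ
  have hi := image_card_le d hd c m ζ hζ hζ1 μ hμ0
  have h7 := mul_le_mul_of_nonneg_left sm (by positivity : 0 ≤ 4 / μ ^ 2)
  have h8 : 4 / μ ^ 2 * (3 * ε * μ ^ 2 * q + 2 * d * μ * (q + B) + 3 * μ ^ 2 * B) =
      12 * ε * q + 8 * d * q / μ + 8 * d * B / μ + 12 * B := by
    field_simp
    ring
  have h9 : 8 * d * B / μ ≤ 8 * d * B := div_le_self (by positivity) hμ1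
  have h10 : 2 * q / μ + 8 * d * q / μ ≤ η / 2 * q := by
    rw [div_le_iff₀ hη] at hμ2
    rw [← add_div, div_le_iff₀ hμ0]
    nlinarith
  have h11 : 12 * ε * q ≤ η / 2 * q := by nlinarith
  push_cast
  rw [h8] at h7
  rw [← hq] at hi ⊢
  linarith

end image

section final

lemma exists_root_unity {k : Type u} [Field k] [Fintype k] (d p : ℕ) (hd : 2 ≤ d) [CharP k p]
    (hp : p.Prime) (h1 : p ≡ 1 [MOD d]) : ∃ ζ : k, ζ ^ d = 1 ∧ ζ ≠ 1 := by
  classical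
  obtain ⟨n, -, hn⟩ := FiniteField.card k p
  have hl := Nat.minFac_prime (show d ≠ 1 by omega)
  have hld := Nat.minFac_dvd d
  haveI : Fact d.minFac.Prime := ⟨hl⟩
  have h2 : 1 ≡ Fintype.card k [MOD d] := by
    rw [hn]
    simpa using (h1.pow n).symm
  have h3 : d ∣ Fintype.card kˣ := by
    rw [Fintype.card_units]
    exact (Nat.modEq_iff_dvd' Fintype.card_pos).1 h2
  obtain ⟨u, hu⟩ := exists_prime_orderOf_dvd_card d.minFac (hld.trans h3)
  refine ⟨u, ?_, ?_⟩
  · rw [← Units.val_pow_eq_pow_val, orderOf_dvd_iff_pow_eq_one.1 (hu ▸ hld), Units.val_one]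
  · intro h
    rw [Units.val_eq_one] at h
    rw [h, orderOf_one] at hu
    exact hl.one_lt.ne hu

lemma periodic_mem_range {α : Type*} (g : α → α) (z : α) (n : ℕ) (h : ∃ m, 0 < m ∧ g^[m] z = z) :
    ∃ y, g^[n] y = z := by
  obtain ⟨m, hm, hz⟩ := h
  have h1 : ∀ j, g^[m * j] z = z := by
    intro j
    rw [Function.iterate_mul]
    exact Function.iterate_fixed hz j
  refine ⟨g^[m * n - n] z, ?_⟩
  rw [← Function.iterate_add_apply, Nat.add_sub_cancel' (Nat.le_mul_of_pos_left n hm), h1]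

lemma absNorm_bound {K : Type u} [Field K] [NumberField K] (𝔭 : Ideal (𝓞 K)) (x : 𝓞 K) (hx : x ≠ 0)
    (h : Ideal.absNorm (Ideal.span {x}) < Ideal.absNorm 𝔭) : x ∉ 𝔭 := by
  intro hm
  have h1 : 𝔭 ∣ Ideal.span {x} := by
    rw [Ideal.dvd_iff_le, Ideal.span_singleton_le_iff_mem]
    exact hm
  have h2 : Ideal.absNorm 𝔭 ∣ Ideal.absNorm (Ideal.span {x}) := map_dvd Ideal.absNorm h1
  have h3 : Ideal.absNorm (Ideal.span {x}) ≠ 0 := by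
    rw [Ne, Ideal.absNorm_eq_zero_iff, Ideal.span_singleton_eq_bot]
    exact hx
  exact absurd (Nat.le_of_dvd (Nat.pos_of_ne_zero h3) h2) (by omega)

lemma exists_prime_above (K : Type u) [Field K] [NumberField K] (p : ℕ) (hp : p.Prime) :
    ∃ 𝔭 : Ideal (𝓞 K), 𝔭.IsPrime ∧ 𝔭 ≠ ⊥ ∧ (p : 𝓞 K) ∈ 𝔭 := by
  have hnu : Ideal.span {(p : 𝓞 K)} ≠ ⊤ := by
    rw [Ne, ← Ideal.absNorm_eq_one_iff, Ideal.absNorm_span_singleton]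
    have : (p : 𝓞 K) = algebraMap ℤ (𝓞 K) (p : ℤ) := by simp
    rw [this, Algebra.norm_algebraMap, Int.natAbs_pow, Int.natAbs_natCast, Nat.pow_eq_one]
    rintro (h | h)
    · exact hp.one_lt.ne' h
    · exact Module.finrank_pos.ne' h
  obtain ⟨𝔭, hm, hle⟩ := Ideal.exists_le_maximal _ hnu
  have hmem := (Ideal.span_singleton_le_iff_mem _).1 hle
  refine ⟨𝔭, hm.isPrime, ?_, hmem⟩
  rintro rfl
  rw [Ideal.mem_bot, Nat.cast_eq_zero] at hmem
  exact hp.ne_zero hmem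

lemma perCount_le {K : Type u} [Field K] [NumberField K] (d : ℕ) (hd : 2 ≤ d) (c : 𝓞 K)
    (f : Polynomial (𝓞 K)) (hf : f = X ^ d + C c) (m B : ℕ) (η : ℝ)
    (hB : ∀ (k : Type u) [Field k] [Fintype k] [DecidableEq k] (c : k) (p : ℕ) [CharP k p],
      p.Prime → B ≤ p → (d : k) ≠ 0 → OrbInj d c m → (∃ ζ : k, ζ ^ d = 1 ∧ ζ ≠ 1) →
      ((Finset.univ.image (fit d c k (m + 1))).card : ℝ) ≤ η * Fintype.card k + B)
    (p : ℕ) (hp : p.Prime) (hpB : B ≤ p) (hpd : d < p) (hp1 : p ≡ 1 [MOD d])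
    (𝔭 : Ideal (𝓞 K)) (h𝔭 : 𝔭.IsPrime) (h0 : 𝔭 ≠ ⊥) (hmem : (p : 𝓞 K) ∈ 𝔭)
    (horb : p ≤ Ideal.absNorm 𝔭 → ∀ a b, a ≤ m + 1 → b ≤ m + 1 →
      (fun z => f.eval z)^[a] 0 - (fun z => f.eval z)^[b] 0 ∈ 𝔭 → a = b) :
    p ≤ Ideal.absNorm 𝔭 ∧ (perCount f 𝔭 : ℝ) ≤ η * Ideal.absNorm 𝔭 + B := by
  classical
  haveI : 𝔭.IsMaximal := h𝔭.isMaximal h0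
  letI : Field (𝓞 K ⧸ 𝔭) := Ideal.Quotient.field 𝔭
  haveI : Finite (𝓞 K ⧸ 𝔭) := Ideal.finiteQuotientOfFreeOfNeBot 𝔭 h0
  letI : Fintype (𝓞 K ⧸ 𝔭) := Fintype.ofFinite _
  have hpz : (p : 𝓞 K ⧸ 𝔭) = 0 := by
    rw [← map_natCast (Ideal.Quotient.mk 𝔭)]
    exact Ideal.Quotient.eq_zero_iff_mem.2 hmem
  haveI : CharP (𝓞 K ⧸ 𝔭) p := ringChar.of_eq (CharP.ringChar_of_prime_eq_zero hp hpz)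
  have hq : Ideal.absNorm 𝔭 = Fintype.card (𝓞 K ⧸ 𝔭) := by
    rw [Ideal.absNorm_apply, Submodule.cardQuot_apply, Nat.card_eq_fintype_card]
  have hpq : p ≤ Ideal.absNorm 𝔭 := by
    rw [hq]
    obtain ⟨n, -, hn⟩ := FiniteField.card (𝓞 K ⧸ 𝔭) p
    rw [hn]
    exact Nat.le_self_pow n.ne_zero p
  have hdk : (d : 𝓞 K ⧸ 𝔭) ≠ 0 := by
    rw [Ne, CharP.cast_eq_zero_iff (𝓞 K ⧸ 𝔭) p]
    exact fun h => absurd (Nat.le_of_dvd (by omega) h) (by omega)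
  have hit : ∀ n, ∀ z : 𝓞 K ⧸ 𝔭, (fun w => (f.map (Ideal.Quotient.mk 𝔭)).eval w)^[n] z =
      fit d (Ideal.Quotient.mk 𝔭 c) (𝓞 K ⧸ 𝔭) n z := by
    intro n
    induction n with
    | zero => intro z; rfl
    | succ n ih =>
      intro z
      rw [Function.iterate_succ_apply', ih, fit_succ', hf]
      simp
  have hit0 : ∀ n, Ideal.Quotient.mk 𝔭 ((fun z => f.eval z)^[n] 0) =
      fit d (Ideal.Quotient.mk 𝔭 c) (𝓞 K ⧸ 𝔭) n 0 := by
    intro n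
    induction n with
    | zero => simp [fit_zero]
    | succ n ih =>
      rw [Function.iterate_succ_apply', fit_succ', ← ih, hf]
      simp
  have hN : OrbInj d (Ideal.Quotient.mk 𝔭 c) m := by
    intro a b ha hb hab
    refine horb hpq a b ha hb ?_
    rw [← hit0, ← hit0] at hab
    exact Ideal.Quotient.eq.1 hab
  have key := hB (𝓞 K ⧸ 𝔭) (Ideal.Quotient.mk 𝔭 c) p hp hpB hdk hN
    (exists_root_unity d p hd hp hp1)
  refine ⟨hpq, ?_⟩
  rw [hq]
  refine le_trans ?_ key
  have : perCount f 𝔭 ≤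
      (Finset.univ.image (fit d (Ideal.Quotient.mk 𝔭 c) (𝓞 K ⧸ 𝔭) (m + 1))).card := by
    rw [perCount, ← Set.ncard_coe_finset]
    refine Set.ncard_le_ncard ?_ (Finset.finite_toSet _)
    intro z hz
    obtain ⟨y, hy⟩ := periodic_mem_range _ z (m + 1) hz
    rw [hit] at hy
    simp only [Finset.coe_image, Finset.coe_univ, Set.image_univ, Set.mem_range]
    exact ⟨y, hy⟩
  exact_mod_cast this

end final

/-- For `f(x) = x^d + c` over `𝓞_K` with `d ≥ 2` and `0` not
preperiodic under `f`, the liminf over primes `𝔭` of `#Per(f_𝔭)/(N(𝔭)+1)` is `0`: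
for every `ε > 0` there are infinitely many nonzero primes `𝔭` with
`#Per(f_𝔭) ≤ ε·(N(𝔭) + 1)`. -/
theorem unicritical_liminf_zero {K : Type*} [Field K] [NumberField K]
    (d : ℕ) (hd : 2 ≤ d) (c : 𝓞 K) (f : Polynomial (𝓞 K))
    (hf : f = X ^ d + C c)
    (hwander : ∀ m n : ℕ, n < m → (fun z => f.eval z)^[m] 0 ≠ (fun z => f.eval z)^[n] 0) :
    ∀ ε : ℝ, 0 < ε →
      {𝔭 : Ideal (𝓞 K) | 𝔭.IsPrime ∧ 𝔭 ≠ ⊥ ∧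
        (perCount f 𝔭 : ℝ) ≤ ε * ((Ideal.absNorm 𝔭 : ℝ) + 1)}.Infinite := by
  intro ε hε
  refine Set.Infinite.of_image (fun 𝔭 : Ideal (𝓞 K) => Ideal.absNorm 𝔭)
    (Set.infinite_of_forall_exists_gt fun N => ?_)
  obtain ⟨m, B, hB⟩ := imageBound d hd (ε / 2) (by positivity)
  set g : ℕ → 𝓞 K := fun n => (fun z => f.eval z)^[n] 0 with hg
  have hinj : ∀ a b, g a = g b → a = b := by
    intro a b hab
    rcases lt_trichotomy a b with h | h | h
    · exact absurd hab.symm (hwander b a h)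
    · exact h
    · exact absurd hab (hwander a b h)
  set A : ℕ := ∑ a ∈ Finset.range (m + 2), ∑ b ∈ Finset.range (m + 2),
    Ideal.absNorm (Ideal.span {g a - g b}) with hA
  obtain ⟨p, hp, hlt, hp1⟩ := Nat.exists_prime_gt_modEq_one
    (N + B + d + A + ⌈2 * B / ε⌉₊) (show d ≠ 0 by omega)
  obtain ⟨𝔭, h1, h2, h3⟩ := exists_prime_above K p hp
  obtain ⟨hpq, hle⟩ := perCount_le d hd c f hf m B (ε / 2) hB p hp (by omega) (by omega) hp1 𝔭 h1 h2 h3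
    (by
      intro hpq a b ha hb hab
      by_contra hne
      refine absNorm_bound 𝔭 (g a - g b) (sub_ne_zero.2 fun h => hne (hinj a b h)) ?_ hab
      have hA1 : Ideal.absNorm (Ideal.span {g a - g b}) ≤ A := by
        refine le_trans ?_ (Finset.single_le_sum (f := fun a => ∑ b ∈ Finset.range (m + 2),
          Ideal.absNorm (Ideal.span {g a - g b}))
          (fun _ _ => Nat.zero_le _) (Finset.mem_range.2 (by omega : a < m + 2)))
        exact Finset.single_le_sum (f := fun b => Ideal.absNorm (Ideal.span {g a - g b}))
          (fun _ _ => Nat.zero_le _) (Finset.mem_range.2 (by omega : b < m + 2))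
      omega)
  refine ⟨Ideal.absNorm 𝔭, ⟨𝔭, ⟨h1, h2, ?_⟩, rfl⟩, by omega⟩
  have h4 : ⌈2 * B / ε⌉₊ ≤ Ideal.absNorm 𝔭 := by omega
  have h5 : 2 * B / ε ≤ Ideal.absNorm 𝔭 := (Nat.le_ceil _).trans (by exact_mod_cast h4)
  rw [div_le_iff₀ hε] at h5
  linarith
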